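/- arXiv:1509.04167 — 3 statements merged into one kernel-verified Lean document; each statement's English description precedes it below -/
import Mathlib

section
/- Let X be a countable commutative additive monoid, d, n ≥ 1 integers and k ∈ {1,…,n}. For j ∈ {1,…,n} and r ∈ {1,…,d}, let p_j, q_{j,r} ∈ [0,1] with Σ_{r=1}^d q_{j,r} = 1 and λ_r := Σ_{j=1}^n p_j q_{j,r} > 0, and let U_r be probability mass functions in ℓ¹(X). Set Q_j = Σ_{r=1}^d q_{j,r} U_r, λ = Σ_{j=1}^n p_j, Q = (1/λ) Σ_{j=1}^n p_j Q_j, R_j = p_j(Q_j − δ₀), V_j = (δ₀ + R_j) * exp(−R_j) − δ₀, M_k = Σ_{J⊆{1,…,n}, |J|=k} ∏_{j∈J} V_j, and H_k = M_k * exp(λ(Q − δ₀)). Set α₁ = Σ_{j=1}^n g(2p_j) p_j² Σ_{r=1}^d q_{j,r} · min{ q_{j,r}/(2^{3/2} λ_r), 2 }. Then ‖H_k‖ ≤ ( √((2k)!) / (k! · 2^k) ) · (2^{3/2} α₁)^k. -/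
open scoped Classical BigOperators

noncomputable section

namespace PaperL1

variable {X : Type*} [AddCommMonoid X]

/-- Convolution of two summable functions on an additive commutative monoid:
`(f ⋆ g) x = Σ_{(y,z) : y + z = x} f y * g z`. -/
def conv (f g : X → ℝ) : X → ℝ :=
  fun x => ∑' p : {p : X × X // p.1 + p.2 = x}, f p.1.1 * g p.1.2

/-- The Dirac delta at a point: the unit of the convolution algebra is `delta 0`. -/
def delta (x₀ : X) : X → ℝ := fun x => if x = x₀ then 1 else 0

/-- Convolution powers, with `f^{*0} = δ₀`. -/
def convPow (f : X → ℝ) : ℕ → (X → ℝ)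
  | 0 => delta 0
  | n + 1 => conv f (convPow f n)

/-- The exponential in the convolution algebra: `exp f = Σ_m f^{*m}/m!`. -/
def convExp (f : X → ℝ) : X → ℝ :=
  fun x => ∑' m : ℕ, ((m.factorial : ℝ))⁻¹ * convPow f m x

/-- Convolution product over a finite (linearly ordered) index set; the empty
product is `δ₀`. -/
def convProd {ι : Type*} [LinearOrder ι] (s : Finset ι) (f : ι → X → ℝ) : X → ℝ :=
  (s.sort (· ≤ ·)).foldr (fun i acc => conv (f i) acc) (delta 0)

/-- The ℓ¹ norm: `‖f‖ = Σ_x |f x|`. -/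
def l1norm (f : X → ℝ) : ℝ := ∑' x, |f x|

/-- A probability mass function: nonnegative values summing to `1`. -/
def IsPmf (f : X → ℝ) : Prop := (∀ x, 0 ≤ f x) ∧ HasSum f 1

/-- The function `g(x) = 2 Σ_{m=2}^∞ (m-1) x^{m-2} / m!`. -/
def gfun (x : ℝ) : ℝ := ∑' m : ℕ, 2 * (m + 1) * x ^ m / ((m + 2).factorial : ℝ)

end PaperL1

namespace PaperAux
set_option linter.unusedSectionVars false
set_option linter.unusedVariables false

section FockPart

theorem pi_prod_tsum {B : Type*} [NormedCommRing B] [CompleteSpace B] :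
    ∀ (d : ℕ) (f : Fin d → ℕ → B), (∀ r, Summable fun n => ‖f r n‖) →
      Summable (fun x : Fin d → ℕ => ‖∏ r, f r (x r)‖) ∧
      ∑' x : Fin d → ℕ, ∏ r, f r (x r) = ∏ r, ∑' n, f r n := by
  intro d
  induction d with
  | zero =>
    intro f hf
    refine ⟨?_, ?_⟩
    · exact Summable.of_finite
    · rw [tsum_eq_single (default : Fin 0 → ℕ)]
      · simp
      · intro b hb
        exact absurd (Subsingleton.elim _ _) hb
  | succ d ih =>
    intro f hf
    obtain ⟨h1, h2⟩ := ih (fun r => f r.succ) (fun r => hf _)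
    have e : ∀ z : ℕ × (Fin d → ℕ), ∏ r, f r ((Fin.consEquiv (fun _ => ℕ)) z r)
        = f 0 z.1 * ∏ r, f (Fin.succ r) (z.2 r) := by
      intro z
      rw [Fin.prod_univ_succ]
      simp [Fin.consEquiv]
    constructor
    · rw [← (Fin.consEquiv (fun _ => ℕ)).summable_iff]
      have := Summable.mul_norm (hf 0) h1
      refine this.congr ?_
      intro z
      simp only [Function.comp]
      rw [e z]
    · rw [← (Fin.consEquiv (fun _ => ℕ)).tsum_eq]
      simp_rw [e]
      rw [Fin.prod_univ_succ, ← h2]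
      exact (tsum_mul_tsum_of_summable_norm (hf 0) h1).symm

/-- exponentially bounded functions -/
def EB {d : ℕ} {B : Type*} [Norm B] (F : (Fin d → ℕ) → B) : Prop :=
  ∃ K : ℝ, 1 ≤ K ∧ ∀ x, ‖F x‖ ≤ K ^ (∑ r, x r + 1)

/-- unit vector -/
def eu {d : ℕ} (r : Fin d) : Fin d → ℕ := fun s => if s = r then 1 else 0

theorem eu_self {d : ℕ} (r : Fin d) : eu r r = 1 := by simp [eu]

theorem eu_ne {d : ℕ} {r s : Fin d} (h : s ≠ r) : eu r s = 0 := by simp [eu, h]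

theorem sum_eu {d : ℕ} (r : Fin d) : ∑ s, eu r s = 1 := by simp [eu]

/-- Poisson weight -/
def wt {d : ℕ} (lam : Fin d → ℝ) (x : Fin d → ℕ) : ℝ :=
  ∏ r, (Real.exp (-lam r) * (lam r ^ x r / (x r).factorial))

/-- creation operator -/
def Dop {d : ℕ} (lam : Fin d → ℝ) (r : Fin d) : Module.End ℝ ((Fin d → ℕ) → ℝ) where
  toFun h := fun x => (x r : ℝ) / lam r * h (x - eu r) - h x
  map_add' f g := by ext x; simp; ring
  map_smul' c f := by ext x; simp; ring

/-- forward difference -/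
def Nab {d : ℕ} (r : Fin d) : Module.End ℝ ((Fin d → ℕ) → ℝ) where
  toFun h := fun x => h (x + eu r) - h x
  map_add' f g := by ext x; simp; ring
  map_smul' c f := by ext x; simp; ring

theorem Dop_apply {d : ℕ} (lam : Fin d → ℝ) (r : Fin d) (h : (Fin d → ℕ) → ℝ) (x) :
  Dop lam r h x = (x r : ℝ) / lam r * h (x - eu r) - h x := rfl

theorem Nab_apply {d : ℕ} (r : Fin d) (h : (Fin d → ℕ) → ℝ) (x) :
  Nab r h x = h (x + eu r) - h x := rfl

theorem comm_rel {d : ℕ} (lam : Fin d → ℝ) (r s : Fin d) (h : (Fin d → ℕ) → ℝ) :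
    Nab r (Dop lam s h) = Dop lam s (Nab r h) + (if r = s then (lam s)⁻¹ else 0) • h := by
  ext x
  simp only [Nab_apply, Dop_apply, Pi.add_apply, Pi.smul_apply, smul_eq_mul]
  by_cases hrs : r = s
  · subst hrs
    have h1 : x + eu r - eu r = x := by ext t; simp
    rw [h1, eu_self]
    by_cases hx : x r = 0
    · simp [hx]; ring
    · have h2 : x - eu r + eu r = x := by
        ext t
        by_cases ht : t = r
        · subst ht; simp [eu_self]; omega
        · simp [eu_ne ht]
      rw [h2]; push_cast; simp; ring
  · have h2 : x - eu s + eu r = x + eu r - eu s := by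
      ext t
      by_cases ht : t = s
      · subst ht; simp [eu_ne (Ne.symm hrs)]
      · simp [eu_ne ht]
    rw [h2, eu_ne (Ne.symm hrs)]
    simp [hrs]; ring

section
variable {d : ℕ} {B : Type*} [NormedCommRing B] [NormedAlgebra ℝ B]

theorem EB.add {F G : (Fin d → ℕ) → B} (hF : EB F) (hG : EB G) : EB (F + G) := by
  obtain ⟨K, hK, h⟩ := hF
  obtain ⟨L, hL, h'⟩ := hG
  refine ⟨K + L, by linarith, fun x => ?_⟩
  refine (norm_add_le _ _).trans ((add_le_add (h x) (h' x)).trans ?_)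
  exact pow_add_pow_le (by linarith) (by linarith) (by omega)

theorem EB.smul' {f : (Fin d → ℕ) → ℝ} {G : (Fin d → ℕ) → B} (hF : EB f) (hG : EB G) :
    EB (fun x => f x • G x) := by
  obtain ⟨K, hK, h⟩ := hF
  obtain ⟨L, hL, h'⟩ := hG
  refine ⟨K * L, by nlinarith, fun x => ?_⟩
  rw [norm_smul, mul_pow]
  have := h x
  have := h' x
  gcongr
 
theorem EB.mul {f g : (Fin d → ℕ) → ℝ} (hF : EB f) (hG : EB g) :
    EB (fun x => f x * g x) := EB.smul' hF hG

theorem EB.const (c : ℝ) : EB (fun _ : Fin d → ℕ => c) := by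
  refine ⟨|c| + 1, by linarith [abs_nonneg c], fun x => ?_⟩
  rw [Real.norm_eq_abs]
  calc |c| ≤ |c| + 1 := by linarith
    _ = (|c| + 1) ^ 1 := by ring
    _ ≤ _ := pow_le_pow_right₀ (by linarith [abs_nonneg c]) (by omega)

theorem EB.smulc {G : (Fin d → ℕ) → B} (c : ℝ) (hG : EB G) : EB (c • G) :=
  EB.smul' (EB.const c) hG

theorem EB.sub {F G : (Fin d → ℕ) → B} (hF : EB F) (hG : EB G) : EB (F - G) := by
  have := hF.add (hG.smulc (-1))
  simpa [sub_eq_add_neg] using this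

theorem EB.coord (r : Fin d) : EB (fun x : Fin d → ℕ => (x r : ℝ)) := by
  refine ⟨2, by norm_num, fun x => ?_⟩
  rw [Real.norm_eq_abs, abs_of_nonneg (by positivity)]
  have h1 : (x r) ≤ ∑ s, x s := Finset.single_le_sum (f := x) (fun _ _ => Nat.zero_le _) (Finset.mem_univ r)
  have h2 : ∑ s, x s + 1 < 2 ^ (∑ s, x s + 1) := Nat.lt_two_pow_self
  have : x r ≤ 2 ^ (∑ s, x s + 1) := by omega
  show ((x r : ℕ) : ℝ) ≤ _
  exact_mod_cast this

theorem EB.shift_up {F : (Fin d → ℕ) → B} (hF : EB F) (r : Fin d) :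
    EB (fun x => F (x + eu r)) := by
  obtain ⟨K, hK, h⟩ := hF
  refine ⟨K ^ 2, by nlinarith, fun x => (h _).trans ?_⟩
  rw [← pow_mul]
  apply pow_le_pow_right₀ hK
  simp only [Pi.add_apply, Finset.sum_add_distrib, sum_eu]
  omega

theorem EB.shift_down {F : (Fin d → ℕ) → B} (hF : EB F) (r : Fin d) :
    EB (fun x => F (x - eu r)) := by
  obtain ⟨K, hK, h⟩ := hF
  refine ⟨K, hK, fun x => (h _).trans ?_⟩
  apply pow_le_pow_right₀ hK
  have : ∑ s, (x - eu r) s ≤ ∑ s, x s := Finset.sum_le_sum fun s _ => by simp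
  omega

theorem EB.nab {h : (Fin d → ℕ) → ℝ} (hh : EB h) (r : Fin d) : EB (Nab r h) :=
  (hh.shift_up r).sub hh

theorem EB.dop {h : (Fin d → ℕ) → ℝ} (hh : EB h) (lam : Fin d → ℝ) (r : Fin d) :
    EB (Dop lam r h) := by
  have := (((EB.coord r).mul (EB.const (lam r)⁻¹)).mul (hh.shift_down r)).sub hh
  exact this

theorem EB.zero : EB (0 : (Fin d → ℕ) → B) := ⟨1, le_rfl, fun x => by simp⟩

theorem EB.sum {ι : Type*} (s : Finset ι) {F : ι → (Fin d → ℕ) → B} (hF : ∀ i ∈ s, EB (F i)) :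
    EB (∑ i ∈ s, F i) := Finset.sum_induction F EB (fun _ _ => EB.add) EB.zero hF

theorem wt_nonneg {lam : Fin d → ℝ} (hl : ∀ r, 0 < lam r) (x : Fin d → ℕ) : 0 ≤ wt lam x :=
  Finset.prod_nonneg fun r _ => by have := hl r; positivity

theorem summable_wt {lam : Fin d → ℝ} (hl : ∀ r, 0 < lam r) {F : (Fin d → ℕ) → B} (hF : EB F) :
    Summable fun x => ‖wt lam x • F x‖ := by
  obtain ⟨K, hK, h⟩ := hF
  have h1 := (pi_prod_tsum d (fun r (n : ℕ) => Real.exp (-lam r) * ((lam r * K) ^ n / n.factorial))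
    (fun r => ((Real.summable_pow_div_factorial (lam r * K)).mul_left _).norm)).1
  refine Summable.of_nonneg_of_le (fun x => norm_nonneg _) (fun x => ?_) (h1.mul_right K)
  rw [norm_smul]
  refine (mul_le_mul_of_nonneg_left (h x) (norm_nonneg _)).trans (le_of_eq ?_)
  rw [pow_succ, ← mul_assoc]
  congr 1
  have hKK : K ^ (∑ r, x r) = ‖K ^ (∑ r, x r)‖ := by
    rw [Real.norm_of_nonneg]; positivity
  rw [hKK, ← norm_mul, wt, ← Finset.prod_pow_eq_pow_sum, ← Finset.prod_mul_distrib]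
  congr 1
  apply Finset.prod_congr rfl
  intro r _
  rw [mul_pow]; ring

theorem wt_shift {lam : Fin d → ℝ} (hl : ∀ r, 0 < lam r) (x : Fin d → ℕ) (r : Fin d) :
    wt lam (x + eu r) * (((x + eu r) r : ℕ) / lam r) = wt lam x := by
  unfold wt
  rw [← Finset.mul_prod_erase Finset.univ _ (Finset.mem_univ r),
    ← Finset.mul_prod_erase Finset.univ (fun r => _ * (lam r ^ x r / _)) (Finset.mem_univ r)]
  have h1 : ∏ s ∈ Finset.univ.erase r, (Real.exp (-lam s) * (lam s ^ (x + eu r) s / ((x + eu r) s).factorial))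
     = ∏ s ∈ Finset.univ.erase r, (Real.exp (-lam s) * (lam s ^ x s / (x s).factorial)) := by
    apply Finset.prod_congr rfl
    intro s hs
    rw [Pi.add_apply, eu_ne (Finset.ne_of_mem_erase hs), add_zero]
  rw [h1]
  have := hl r
  simp only [Pi.add_apply, eu_self, Nat.factorial_succ]
  push_cast
  field_simp
  ring

theorem adj {lam : Fin d → ℝ} [CompleteSpace B] (hl : ∀ r, 0 < lam r) {h : (Fin d → ℕ) → ℝ} (hh : EB h)
    {F : (Fin d → ℕ) → B} (hF : EB F) (r : Fin d) :
    ∑' x, wt lam x • (Dop lam r h x • F x) =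
      ∑' x, wt lam x • (h x • (F (x + eu r) - F x)) := by
  have e0 := (((EB.coord r).mul (EB.const (lam r)⁻¹)).mul (hh.shift_down r)).smul' hF
  have s0 := (summable_wt hl e0).of_norm
  have s1 := (summable_wt hl (hh.smul' hF)).of_norm
  have s2 := (summable_wt hl (hh.smul' (hF.shift_up r))).of_norm
  have l1 : ∀ x, wt lam x • (Dop lam r h x • F x) =
     wt lam x • (((x r : ℝ) * (lam r)⁻¹ * h (x - eu r)) • F x) - wt lam x • (h x • F x) := by
    intro x
    rw [Dop_apply, sub_smul, smul_sub, div_eq_mul_inv]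
  simp_rw [l1, smul_sub]
  rw [s0.tsum_sub s1, s2.tsum_sub s1]
  congr 1
  have inj : Function.Injective (fun x : Fin d → ℕ => x + eu r) := fun a b hab => add_right_cancel hab
  rw [← inj.tsum_eq]
  · apply tsum_congr
    intro x
    have hx : x + eu r - eu r = x := by ext t; simp
    rw [hx, ← wt_shift hl x r]
    simp only [smul_smul]
    congr 1
    ring
  · intro x hx
    have hx0 : x r ≠ 0 := by
      intro h0
      apply hx
      simp [h0]
    refine ⟨x - eu r, ?_⟩
    ext t
    by_cases ht : t = r
    · subst ht; simp [eu_self]; omega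
    · simp [eu_ne ht]

end

end FockPart
end PaperAux

namespace PaperAux
section FockPart2
variable {d : ℕ}

theorem Dop_comm (lam : Fin d → ℝ) (r s : Fin d) (h : (Fin d → ℕ) → ℝ) :
    Dop lam r (Dop lam s h) = Dop lam s (Dop lam r h) := by
  by_cases hrs : r = s
  · subst hrs; rfl
  ext x
  simp only [Dop_apply]
  have h1 : (x - eu r) s = x s := by simp [eu_ne (Ne.symm hrs)]
  have h2 : (x - eu s) r = x r := by simp [eu_ne hrs]
  have h3 : x - eu r - eu s = x - eu s - eu r := by
    ext t; simp; omega
  rw [h1, h2, h3]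
  ring

/-- creation operator of a vector -/
def Ca (lam : Fin d → ℝ) (a : Fin d → ℝ) : Module.End ℝ ((Fin d → ℕ) → ℝ) :=
  ∑ r, a r • Dop lam r

/-- annihilation operator of a vector -/
def Na (a : Fin d → ℝ) : Module.End ℝ ((Fin d → ℕ) → ℝ) :=
  ∑ r, a r • Nab r

/-- number operator -/
def Nu (lam : Fin d → ℝ) : Module.End ℝ ((Fin d → ℕ) → ℝ) :=
  ∑ r, lam r • (Dop lam r * Nab r)

theorem Ca_apply (lam a : Fin d → ℝ) (h) : Ca lam a h = ∑ r, a r • Dop lam r h := by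
  simp [Ca, LinearMap.sum_apply]

theorem Na_apply (a : Fin d → ℝ) (h) : Na a h = ∑ r, a r • Nab r h := by
  simp [Na, LinearMap.sum_apply]

theorem Nu_apply (lam : Fin d → ℝ) (h) : Nu lam h = ∑ r, lam r • Dop lam r (Nab r h) := by
  simp [Nu, LinearMap.sum_apply]

theorem Nab_Ca (lam a : Fin d → ℝ) (r : Fin d) (h) :
    Nab r (Ca lam a h) = Ca lam a (Nab r h) + (a r * (lam r)⁻¹) • h := by
  rw [Ca_apply, Ca_apply, map_sum]
  simp_rw [map_smul, comm_rel, smul_add, Finset.sum_add_distrib]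
  congr 1
  simp [smul_smul, ← Finset.sum_smul]

theorem Dop_Ca (lam a : Fin d → ℝ) (r : Fin d) (h) :
    Dop lam r (Ca lam a h) = Ca lam a (Dop lam r h) := by
  rw [Ca_apply, Ca_apply, map_sum]
  simp_rw [map_smul, Dop_comm lam r]

theorem Nu_Ca (lam a : Fin d → ℝ) (hl : ∀ r, 0 < lam r) (h) :
    Nu lam (Ca lam a h) = Ca lam a (Nu lam h) + Ca lam a h := by
  rw [Nu_apply, Nu_apply, map_sum]
  simp_rw [Nab_Ca, map_add, Dop_Ca, smul_add, Finset.sum_add_distrib, map_smul]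
  congr 1
  rw [Ca_apply]
  apply Finset.sum_congr rfl
  intro r _
  rw [smul_smul]
  congr 1
  have := hl r
  field_simp

/-- Fock state -/
def psi (lam : Fin d → ℝ) : List (Fin d → ℝ) → ((Fin d → ℕ) → ℝ)
  | [] => fun _ => 1
  | a :: l => Ca lam a (psi lam l)

theorem EB.abs' {h : (Fin d → ℕ) → ℝ} (hh : EB h) : EB (fun x => |h x|) := by
  obtain ⟨K, hK, h'⟩ := hh
  refine ⟨K, hK, fun x => ?_⟩
  have := h' x
  rw [Real.norm_eq_abs] at this ⊢
  rwa [abs_abs]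

theorem EB.ca {h : (Fin d → ℕ) → ℝ} (hh : EB h) (lam a : Fin d → ℝ) : EB (Ca lam a h) := by
  rw [Ca_apply]
  exact EB.sum _ fun r _ => (hh.dop lam r).smulc _

theorem EB.na {h : (Fin d → ℕ) → ℝ} (hh : EB h) (a : Fin d → ℝ) : EB (Na a h) := by
  rw [Na_apply]
  exact EB.sum _ fun r _ => (hh.nab r).smulc _

theorem EB.nu {h : (Fin d → ℕ) → ℝ} (hh : EB h) (lam : Fin d → ℝ) : EB (Nu lam h) := by
  rw [Nu_apply]
  exact EB.sum _ fun r _ => ((hh.nab r).dop lam r).smulc _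

theorem EB.psi (lam : Fin d → ℝ) (l : List (Fin d → ℝ)) : EB (psi lam l) := by
  induction l with
  | nil => exact EB.const 1
  | cons a l ih => exact ih.ca lam a

theorem Nu_psi (lam : Fin d → ℝ) (hl : ∀ r, 0 < lam r) (l : List (Fin d → ℝ)) :
    Nu lam (psi lam l) = (l.length : ℝ) • psi lam l := by
  induction l with
  | nil =>
    rw [Nu_apply]
    have : ∀ r : Fin d, Nab r (psi lam []) = 0 := by
      intro r; ext x; simp [Nab_apply, psi]
    simp [this]
  | cons a l ih =>
    rw [psi, Nu_Ca lam a hl, ih, map_smul, List.length_cons]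
    push_cast
    rw [add_smul, one_smul]

/-- expectation of product -/
def ip (lam : Fin d → ℝ) (f g : (Fin d → ℕ) → ℝ) : ℝ := ∑' x, wt lam x • (f x * g x)

section
variable {lam : Fin d → ℝ}

theorem ip_comm (f g : (Fin d → ℕ) → ℝ) : ip lam f g = ip lam g f := by
  unfold ip; simp_rw [mul_comm]


theorem ip_add (hl : ∀ r, 0 < lam r) {f g g' : (Fin d → ℕ) → ℝ} (hf : EB f) (hg : EB g) (hg' : EB g') :
    ip lam f (g + g') = ip lam f g + ip lam f g' := by
  unfold ip
  rw [← ((summable_wt hl (hf.mul hg)).of_norm).tsum_add ((summable_wt hl (hf.mul hg')).of_norm)]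
  apply tsum_congr; intro x
  simp; ring

theorem ip_smul (hl : ∀ r, 0 < lam r) (f g : (Fin d → ℕ) → ℝ) (c : ℝ) :
    ip lam f (c • g) = c * ip lam f g := by
  unfold ip
  rw [← tsum_mul_left]
  apply tsum_congr; intro x
  simp; ring

theorem ip_sum (hl : ∀ r, 0 < lam r) {ι : Type*} (s : Finset ι) {f : (Fin d → ℕ) → ℝ} {g : ι → (Fin d → ℕ) → ℝ} (hf : EB f)
    (hg : ∀ i, EB (g i)) :
    ip lam f (∑ i ∈ s, g i) = ∑ i ∈ s, ip lam f (g i) := by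
  induction s using Finset.induction_on with
  | empty => simp [ip]
  | insert a s ha ih =>
    rw [Finset.sum_insert ha, Finset.sum_insert ha, ip_add hl hf (hg a) (EB.sum _ fun i _ => hg i), ih]

theorem ip_dop (hl : ∀ r, 0 < lam r) {h f : (Fin d → ℕ) → ℝ} (hh : EB h) (hf : EB f) (r : Fin d) :
    ip lam (Dop lam r h) f = ip lam h (Nab r f) := adj hl hh hf r

theorem ip_ca (hl : ∀ r, 0 < lam r) {h f : (Fin d → ℕ) → ℝ} (hh : EB h) (hf : EB f) (a : Fin d → ℝ) :
    ip lam (Ca lam a h) f = ip lam h (Na a f) := by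
  rw [ip_comm, Ca_apply, ip_sum hl _ hf (fun r => (hh.dop lam r).smulc _), Na_apply,
    ip_sum hl _ hh (fun r => (hf.nab r).smulc _)]
  apply Finset.sum_congr rfl
  intro r _
  rw [ip_smul hl, ip_smul hl, ip_comm, ip_dop hl hh hf]

theorem ip_mono (hl : ∀ r, 0 < lam r) {f g f' g' : (Fin d → ℕ) → ℝ} (hf : EB f) (hg : EB g) (hf' : EB f') (hg' : EB g')
    (h : ∀ x, f x * g x ≤ f' x * g' x) : ip lam f g ≤ ip lam f' g' := by
  unfold ip
  refine ((summable_wt hl (hf.mul hg)).of_norm).tsum_le_tsum (fun x => ?_)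
    ((summable_wt hl (hf'.mul hg')).of_norm)
  exact mul_le_mul_of_nonneg_left (h x) (wt_nonneg hl x)

theorem ip_self_nonneg (hl : ∀ r, 0 < lam r) (f : (Fin d → ℕ) → ℝ) : 0 ≤ ip lam f f :=
  tsum_nonneg fun x => mul_nonneg (wt_nonneg hl x) (mul_self_nonneg _)

theorem ip_na_le (hl : ∀ r, 0 < lam r) {h : (Fin d → ℕ) → ℝ} (hh : EB h) (a : Fin d → ℝ) :
    ip lam (Na a h) (Na a h) ≤ (∑ r, a r ^ 2 / lam r) * ip lam h (Nu lam h) := by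
  have e1 : ip lam h (Nu lam h) = ∑ r, lam r * ip lam (Nab r h) (Nab r h) := by
    rw [Nu_apply, ip_sum hl _ hh (fun r => ((hh.nab r).dop lam r).smulc _)]
    apply Finset.sum_congr rfl
    intro r _
    rw [ip_smul hl, ip_comm, ip_dop hl (hh.nab r) hh]
  have e2 : (∑ r, a r ^ 2 / lam r) * ip lam h (Nu lam h) =
      ip lam (fun _ => 1) ((∑ r, a r ^ 2 / lam r) • ∑ r, lam r • (fun x => Nab r h x * Nab r h x)) := by
    rw [ip_smul hl, ip_sum hl _ (EB.const 1) (fun r => ((hh.nab r).mul (hh.nab r)).smulc _), e1]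
    congr 1
    apply Finset.sum_congr rfl
    intro r _
    rw [ip_smul hl]
    simp [ip]
  rw [e2]
  apply ip_mono hl (hh.na a) (hh.na a) (EB.const 1)
  · exact EB.smulc _ (EB.sum _ fun r _ => ((hh.nab r).mul (hh.nab r)).smulc _)
  intro x
  rw [Na_apply]
  simp only [Finset.sum_apply, Pi.smul_apply, smul_eq_mul, one_mul]
  have := Finset.sum_mul_sq_le_sq_mul_sq Finset.univ (fun r => a r / Real.sqrt (lam r))
    (fun r => Real.sqrt (lam r) * Nab r h x)
  rw [← sq]
  have f1 : ∀ r, a r / Real.sqrt (lam r) * (Real.sqrt (lam r) * Nab r h x) = a r * Nab r h x := by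
    intro r
    have := Real.sqrt_pos.mpr (hl r)
    field_simp
  have f2 : ∀ r, (a r / Real.sqrt (lam r)) ^ 2 = a r ^ 2 / lam r := by
    intro r
    rw [div_pow, Real.sq_sqrt (hl r).le]
  have f3 : ∀ r, (Real.sqrt (lam r) * Nab r h x) ^ 2 = lam r * (Nab r h x * Nab r h x) := by
    intro r
    rw [mul_pow, Real.sq_sqrt (hl r).le]
    ring
  simp_rw [f1, f2, f3] at this
  exact this

theorem ip_ca_ca (hl : ∀ r, 0 < lam r) {h : (Fin d → ℕ) → ℝ} (hh : EB h) (a : Fin d → ℝ) :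
    ip lam (Ca lam a h) (Ca lam a h) =
      ip lam (Na a h) (Na a h) + (∑ r, a r ^ 2 / lam r) * ip lam h h := by
  rw [ip_ca hl hh (hh.ca lam a)]
  have e : Na a (Ca lam a h) = Ca lam a (Na a h) + (∑ r, a r ^ 2 / lam r) • h := by
    rw [Na_apply, Na_apply, map_sum]
    simp_rw [Nab_Ca, smul_add, Finset.sum_add_distrib, map_smul]
    congr 1
    rw [Finset.sum_smul]
    apply Finset.sum_congr rfl
    intro r _
    rw [smul_smul]; congr 1; ring
  rw [e, ip_add hl hh ((hh.na a).ca lam a) (hh.smulc _), ip_smul hl, ip_comm, ip_ca hl (hh.na a) hh]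

theorem wt_sum (hl : ∀ r, 0 < lam r) : ∑' x, wt lam x = 1 := by
  have := (pi_prod_tsum d (fun r (n : ℕ) => Real.exp (-lam r) * ((lam r) ^ n / n.factorial))
    (fun r => ((Real.summable_pow_div_factorial (lam r)).mul_left _).norm)).2
  unfold wt
  rw [this]
  apply Finset.prod_eq_one
  intro r _
  rw [tsum_mul_left]
  have h2 : ∑' n : ℕ, lam r ^ n / (n.factorial : ℝ) = Real.exp (lam r) := by
    rw [Real.exp_eq_exp_ℝ, NormedSpace.exp_eq_tsum_div]
  rw [h2, ← Real.exp_add]; simp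

theorem ip_one (hl : ∀ r, 0 < lam r) : ip lam (fun _ => 1) (fun _ => 1) = 1 := by
  unfold ip; simpa using wt_sum hl

theorem ip_psi_le (hl : ∀ r, 0 < lam r) (l : List (Fin d → ℝ)) :
    ip lam (psi lam l) (psi lam l) ≤
      (l.length.factorial : ℝ) * (l.map fun a => ∑ r, a r ^ 2 / lam r).prod := by
  induction l with
  | nil => simp [psi, ip_one hl]
  | cons a l ih =>
    have h0 := EB.psi lam l
    rw [psi, ip_ca_ca hl h0 a]
    have h1 := ip_na_le hl h0 a
    rw [Nu_psi lam hl, ip_smul hl] at h1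
    have hA : 0 ≤ ∑ r, a r ^ 2 / lam r := Finset.sum_nonneg fun r _ => by have := hl r; positivity
    rw [List.length_cons, Nat.factorial_succ, List.map_cons, List.prod_cons]
    push_cast
    set A := ∑ r, a r ^ 2 / lam r
    calc _ ≤ A * ((l.length : ℝ) * ip lam (psi lam l) (psi lam l)) + A * ip lam (psi lam l) (psi lam l) := by linarith
      _ = (A * ((l.length : ℝ) + 1)) * ip lam (psi lam l) (psi lam l) := by ring
      _ ≤ (A * ((l.length : ℝ) + 1)) * _ := mul_le_mul_of_nonneg_left ih (by positivity)
      _ = _ := by ring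

end

section
variable {B : Type*} [NormedCommRing B] [NormedAlgebra ℝ B] [CompleteSpace B] [NormOneClass B]
variable {lam : Fin d → ℝ} {u : Fin d → B}

/-- realization map -/
def Phi (lam : Fin d → ℝ) (u : Fin d → B) (h : (Fin d → ℕ) → ℝ) : B :=
  ∑' x, wt lam x • (h x • ∏ r, u r ^ x r)

theorem norm_upow (hu : ∀ r, ‖u r‖ ≤ 1) (x : Fin d → ℕ) : ‖∏ r, u r ^ x r‖ ≤ 1 := by
  refine (Finset.norm_prod_le _ _).trans ?_
  apply Finset.prod_le_one (fun _ _ => norm_nonneg _)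
  intro r _
  exact (norm_pow_le _ _).trans (pow_le_one₀ (norm_nonneg _) (hu r))

theorem EB.upow (hu : ∀ r, ‖u r‖ ≤ 1) : EB (fun x : Fin d → ℕ => ∏ r, u r ^ x r) :=
  ⟨1, le_rfl, fun x => by simpa using norm_upow hu x⟩


theorem Phi_one (hl : ∀ r, 0 < lam r) (hu : ∀ r, ‖u r‖ ≤ 1) : Phi lam u (fun _ => 1) = NormedSpace.exp (∑ r, lam r • (u r - 1)) := by
  letI : NormedAlgebra ℚ B := NormedAlgebra.restrictScalars ℚ ℝ B
  have hs : ∀ r, Summable fun n : ℕ => ‖((Real.exp (-lam r) * (lam r ^ n / n.factorial)) • u r ^ n : B)‖ := by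
    intro r
    have := (NormedSpace.norm_expSeries_summable' (𝕂 := ℝ) (lam r • u r)).mul_left (Real.exp (-lam r))
    refine this.congr ?_
    intro n
    rw [smul_pow, smul_smul, mul_smul (Real.exp (-lam r)), norm_smul (Real.exp (-lam r)), Real.norm_of_nonneg (Real.exp_pos _).le]
    congr 3
    ring
  have := (pi_prod_tsum d (fun r (n : ℕ) => ((Real.exp (-lam r) * (lam r ^ n / n.factorial)) • u r ^ n : B))
    hs).2
  have e : Phi lam u (fun _ => 1) = ∑' x : Fin d → ℕ, ∏ r, ((Real.exp (-lam r) * (lam r ^ x r / (x r).factorial)) • u r ^ x r : B) := by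
    unfold Phi wt
    apply tsum_congr; intro x
    rw [one_smul, Finset.prod_smul]
  rw [e, this, NormedSpace.exp_sum]
  apply Finset.prod_congr rfl
  intro r _
  have h1 : lam r • (u r - 1) = algebraMap ℝ B (-lam r) + lam r • u r := by
    rw [Algebra.algebraMap_eq_smul_one, smul_sub, neg_smul]; abel
  rw [h1, NormedSpace.exp_add, ← NormedSpace.algebraMap_exp_comm, ← Real.exp_eq_exp_ℝ,
    NormedSpace.exp_eq_tsum ℝ, ← Algebra.smul_def, ← Summable.tsum_const_smul _ (NormedSpace.expSeries_summable' (lam r • u r))]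
  apply tsum_congr; intro n
  rw [smul_pow, smul_smul, smul_smul]
  congr 1
  ring

theorem Phi_dop (hl : ∀ r, 0 < lam r) (hu : ∀ r, ‖u r‖ ≤ 1) {h : (Fin d → ℕ) → ℝ} (hh : EB h) (r : Fin d) :
    Phi lam u (Dop lam r h) = (u r - 1) * Phi lam u h := by
  unfold Phi
  rw [adj hl hh (EB.upow hu) r]
  rw [← ((summable_wt hl (hh.smul' (EB.upow hu))).of_norm).tsum_mul_left]
  apply tsum_congr; intro x
  have : ∏ s, u s ^ (x + eu r) s = u r * ∏ s, u s ^ x s := by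
    simp only [Pi.add_apply, pow_add, Finset.prod_mul_distrib]
    rw [mul_comm]
    congr 1
    rw [Finset.prod_eq_single r]
    · rw [eu_self, pow_one]
    · intro b _ hb; rw [eu_ne hb, pow_zero]
    · simp
  rw [this, mul_smul_comm, mul_smul_comm, sub_mul, one_mul]

theorem Phi_ca (hl : ∀ r, 0 < lam r) (hu : ∀ r, ‖u r‖ ≤ 1) {h : (Fin d → ℕ) → ℝ} (hh : EB h) (a : Fin d → ℝ) :
    Phi lam u (Ca lam a h) = (∑ r, a r • (u r - 1)) * Phi lam u h := by
  have e : Phi lam u (Ca lam a h) = ∑ r, a r • Phi lam u (Dop lam r h) := by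
    unfold Phi
    have hs := fun r => ((summable_wt hl ((hh.dop lam r).smul' (EB.upow hu))).of_norm)
    have : ∀ r, a r • ∑' x, wt lam x • (Dop lam r h x • ∏ r, u r ^ x r) =
      ∑' x, a r • wt lam x • (Dop lam r h x • ∏ r, u r ^ x r) := fun r => ((hs r).tsum_const_smul _).symm
    simp_rw [this]
    rw [← Summable.tsum_finsetSum (fun r _ => (hs r).const_smul _)]
    apply tsum_congr; intro x
    rw [Ca_apply]
    simp only [Finset.sum_apply, Pi.smul_apply, smul_eq_mul, Finset.sum_smul, Finset.smul_sum, smul_smul]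
    apply Finset.sum_congr rfl
    intro r _
    congr 1
    ring
  rw [e, Finset.sum_mul]
  apply Finset.sum_congr rfl
  intro r _
  rw [Phi_dop hl hu hh, smul_mul_assoc]

theorem Phi_psi (hl : ∀ r, 0 < lam r) (hu : ∀ r, ‖u r‖ ≤ 1) (l : List (Fin d → ℝ)) :
    Phi lam u (psi lam l) = (l.map fun a => ∑ r, a r • (u r - 1)).prod *
      NormedSpace.exp (∑ r, lam r • (u r - 1)) := by
  induction l with
  | nil => simp [psi, Phi_one hl hu]
  | cons a l ih => rw [psi, Phi_ca hl hu (EB.psi lam l), ih, List.map_cons, List.prod_cons, mul_assoc]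

theorem norm_Phi_le (hl : ∀ r, 0 < lam r) (hu : ∀ r, ‖u r‖ ≤ 1) {h : (Fin d → ℕ) → ℝ} (hh : EB h) : ‖Phi lam u h‖ ≤ Real.sqrt (ip lam h h) := by
  have ha : EB (fun x => |h x|) := EB.abs' hh
  have h1 : ‖Phi lam u h‖ ≤ ip lam (fun _ => 1) (fun x => |h x|) := by
    have s1 : Summable fun x => ‖wt lam x • (h x • ∏ r, u r ^ x r)‖ :=
      summable_wt hl (hh.smul' (EB.upow hu))
    have s2 : Summable fun x => wt lam x • (1 * |h x|) :=
      (summable_wt hl ((EB.const 1).mul ha)).of_norm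
    have s3 : ∑' x, ‖wt lam x • (h x • ∏ r, u r ^ x r)‖ ≤ ∑' x, wt lam x • (1 * |h x|) := by
      refine s1.tsum_le_tsum (fun x => ?_) s2
      rw [norm_smul, norm_smul, Real.norm_of_nonneg (wt_nonneg hl x), smul_eq_mul, one_mul,
        Real.norm_eq_abs]
      apply mul_le_mul_of_nonneg_left _ (wt_nonneg hl x)
      exact mul_le_of_le_one_right (abs_nonneg _) (norm_upow hu x)
    exact (norm_tsum_le_tsum_norm s1).trans s3
  refine h1.trans (Real.le_sqrt_of_sq_le ?_)
  set c := ip lam (fun _ => 1) (fun x => |h x|) with hc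
  have hE1 : EB (fun _ : Fin d → ℕ => (1:ℝ)) := EB.const 1
  have hEc := hE1.smulc (-c)
  have h2 := ip_self_nonneg hl ((fun x => |h x|) + (-c) • (fun _ : Fin d → ℕ => (1:ℝ)))
  rw [ip_add hl (ha.add hEc) ha hEc, ip_smul hl, ip_comm _ (fun x => |h x|), ip_comm _ (fun _ => (1:ℝ)),
    ip_add hl ha ha hEc, ip_add hl hE1 ha hEc, ip_smul hl, ip_smul hl, ip_one hl, ip_comm (fun x => |h x|) (fun _ => (1:ℝ)), ← hc] at h2
  have h3 : ip lam (fun x => |h x|) (fun x => |h x|) = ip lam h h := by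
    unfold ip; simp
  rw [h3] at h2
  nlinarith

theorem key_estimate (hl : ∀ r, 0 < lam r) (hu : ∀ r, ‖u r‖ ≤ 1) (l : List (Fin d → ℝ)) :
    ‖(l.map fun a => ∑ r, a r • (u r - 1)).prod * NormedSpace.exp (∑ r, lam r • (u r - 1))‖ ≤
      Real.sqrt ((l.length.factorial : ℝ) * (l.map fun a => ∑ r, a r ^ 2 / lam r).prod) := by
  rw [← Phi_psi hl hu]
  exact (norm_Phi_le hl hu (EB.psi lam l)).trans (Real.sqrt_le_sqrt (ip_psi_le hl l))

end
end FockPart2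
end PaperAux

namespace PaperAux
open PaperL1
section AbsPart

theorem fact_two (s t : ℕ) : (2 * s).factorial * 2 ^ t ≤ (2 * (s + t)).factorial := by
  induction t with
  | zero => simp
  | succ t ih =>
    have e : 2 * (s + (t + 1)) = 2 * (s + t) + 1 + 1 := by ring
    rw [e, Nat.factorial_succ, Nat.factorial_succ, pow_succ, ← mul_assoc, mul_comm _ 2]
    have h1 : 2 ≤ 2 * (s + t) + 1 + 1 := by omega
    refine Nat.mul_le_mul h1 (ih.trans ?_)
    exact Nat.le_mul_of_pos_left _ (by omega)

theorem esymm_le {ι : Type*} [DecidableEq ι] (s : Finset ι) (t : ι → ℝ) (ht : ∀ i, 0 ≤ t i) :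
    ∀ k, ∑ J ∈ s.powersetCard k, ∏ j ∈ J, t j ≤ (∑ j ∈ s, t j) ^ k / k.factorial := by
  induction s using Finset.induction_on with
  | empty =>
    intro k
    cases k with
    | zero => simp
    | succ k => rw [Finset.powersetCard_eq_empty.mpr (by simp)]; simp
  | insert a s ha ih =>
    intro k
    cases k with
    | zero => simp
    | succ k =>
      rw [Finset.powersetCard_succ_insert ha, Finset.sum_union, Finset.sum_image, Finset.sum_insert ha]
      · have e : ∑ J ∈ s.powersetCard k, ∏ j ∈ insert a J, t j =
            t a * ∑ J ∈ s.powersetCard k, ∏ j ∈ J, t j := by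
          rw [Finset.mul_sum]
          apply Finset.sum_congr rfl
          intro J hJ
          rw [Finset.prod_insert]
          intro h
          exact ha ((Finset.mem_powersetCard.mp hJ).1 h)
        rw [e]
        set S := ∑ j ∈ s, t j
        have hS : 0 ≤ S := Finset.sum_nonneg fun i _ => ht i
        have h1 := ih (k + 1)
        have h2 := mul_le_mul_of_nonneg_left (ih k) (ht a)
        have h3 : S ^ (k + 1) + (k + 1) * (t a * S ^ k) ≤ (t a + S) ^ (k + 1) := by
          clear h1 h2 e
          have hta := ht a
          induction k with
          | zero => simp; linarith
          | succ k ihk =>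
            rw [pow_succ (t a + S)]
            have := mul_le_mul_of_nonneg_right ihk (add_nonneg hta hS)
            refine le_trans ?_ this
            push_cast
            have : 0 ≤ (k + 1) * (t a * t a * S ^ k) := by positivity
            have e5 : (S ^ (k + 1) + ((k:ℝ) + 1) * (t a * S ^ k)) * (t a + S) =
              S ^ (k + 1 + 1) + ((k:ℝ) + 1 + 1) * (t a * S ^ (k + 1)) + (k + 1) * (t a * t a * S ^ k) := by
              ring
            linarith
        have h4 : S ^ (k + 1) / ((k + 1).factorial : ℝ) + t a * (S ^ k / (k.factorial : ℝ)) ≤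
            (t a + S) ^ (k + 1) / ((k + 1).factorial : ℝ) := by
          refine le_trans (le_of_eq ?_) (div_le_div_of_nonneg_right h3 (by positivity))
          rw [Nat.factorial_succ]
          push_cast
          field_simp
        linarith
      · intro J hJ J' hJ' hh
        have h1 : a ∉ J := fun h => ha ((Finset.mem_powersetCard.mp hJ).1 h)
        have h2 : a ∉ J' := fun h => ha ((Finset.mem_powersetCard.mp hJ').1 h)
        rw [← Finset.erase_insert h1, ← Finset.erase_insert h2]
        exact congrArg (fun T => Finset.erase T a) hh
      · rw [Finset.disjoint_left]
        intro J hJ hJ'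
        obtain ⟨J', _, rfl⟩ := Finset.mem_image.mp hJ'
        exact ha ((Finset.mem_powersetCard.mp hJ).1 (Finset.mem_insert_self _ _))

theorem g_summable (x : ℝ) : Summable fun m : ℕ => 2 * (m + 1) * x ^ m / ((m + 2).factorial : ℝ) := by
  refine Summable.of_norm_bounded (g := fun m : ℕ => 2 * (|x| ^ m / m.factorial))
    ((Real.summable_pow_div_factorial |x|).mul_left 2) ?_
  intro m
  have e : 2 * ((m:ℝ) + 1) * x ^ m / ((m + 2).factorial : ℝ) = (2 / (m + 2)) * (x ^ m / m.factorial) := by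
    rw [Nat.factorial_succ, Nat.factorial_succ]
    push_cast
    field_simp
    ring
  rw [e, norm_mul, norm_div, norm_div, norm_pow, Real.norm_eq_abs x]
  have h1 : ‖((m.factorial : ℕ) : ℝ)‖ = (m.factorial : ℝ) := by simp
  rw [h1]
  apply mul_le_mul_of_nonneg_right _ (by positivity)
  rw [Real.norm_of_nonneg (by positivity), Real.norm_of_nonneg (by positivity)]
  exact div_le_self (by norm_num) (by have : (0:ℝ) ≤ m := by positivity
                                      linarith)

theorem g_nonneg {x : ℝ} (hx : 0 ≤ x) : 0 ≤ gfun x :=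
  tsum_nonneg fun m => by positivity

variable {B : Type*} [NormedCommRing B] [NormedAlgebra ℝ B] [CompleteSpace B] [NormOneClass B]

theorem V_repr (R : B) (y : ℝ) (hR : ‖R‖ ≤ y) :
    ∃ G : B, ‖G‖ ≤ gfun y ∧ (1 + R) * NormedSpace.exp (-R) - 1 = (-(1/2) : ℝ) • (R ^ 2 * G) := by
  set z := -R with hz
  have hzn : ‖z‖ ≤ y := by rw [hz, norm_neg]; exact hR
  have hy : 0 ≤ y := (norm_nonneg _).trans hR
  have hterm : ∀ m : ℕ, ‖((2 * (m + 1) / ((m + 2).factorial : ℝ) : ℝ)) • z ^ m‖ ≤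
      2 * (m + 1) * y ^ m / ((m + 2).factorial : ℝ) := by
    intro m
    rw [norm_smul, Real.norm_of_nonneg (by positivity)]
    have : ‖z ^ m‖ ≤ y ^ m := (norm_pow_le _ _).trans (pow_le_pow_left₀ (norm_nonneg _) hzn m)
    calc _ ≤ (2 * (m + 1) / ((m + 2).factorial : ℝ) : ℝ) * y ^ m := mul_le_mul_of_nonneg_left this (by positivity)
      _ = _ := by ring
  have hs : Summable fun m : ℕ => ((2 * (m + 1) / ((m + 2).factorial : ℝ) : ℝ)) • z ^ m :=
    Summable.of_norm_bounded (g_summable y) hterm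
  refine ⟨∑' m : ℕ, ((2 * (m + 1) / ((m + 2).factorial : ℝ) : ℝ)) • z ^ m,
    tsum_of_norm_bounded (g_summable y).hasSum hterm, ?_⟩
  have hR2 : R ^ 2 = z ^ 2 := by rw [hz]; ring
  have hRz : R = -z := by rw [hz]; ring
  rw [hR2, ← hs.tsum_mul_left, ← (hs.mul_left (z ^ 2)).tsum_const_smul]
  have hE := NormedSpace.exp_series_hasSum_exp' (𝕂 := ℝ) z
  have h1 : HasSum (fun n : ℕ => (((n + 1).factorial : ℝ)⁻¹) • z ^ (n + 1)) (NormedSpace.exp z - 1) := by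
    have := (hasSum_nat_add_iff' 1).mpr hE
    simpa using this
  have h2 : HasSum (fun n : ℕ => (((n + 2).factorial : ℝ)⁻¹) • z ^ (n + 2)) (NormedSpace.exp z - 1 - z) := by
    have := (hasSum_nat_add_iff' 2).mpr hE
    simpa [Finset.sum_range_succ, sub_sub] using this
  have h3 := (h2.sub (h1.mul_left z))
  have h4 : HasSum (fun m : ℕ => (-(1/2) : ℝ) • (z ^ 2 * ((2 * (m + 1) / ((m + 2).factorial : ℝ) : ℝ)) • z ^ m))
      (NormedSpace.exp z - 1 - z - z * (NormedSpace.exp z - 1)) := by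
    refine h3.congr_fun ?_
    intro m
    rw [mul_smul_comm, mul_smul_comm, ← pow_succ', ← pow_add, smul_smul, add_comm 2 m,
      show m + 1 + 1 = m + 2 from rfl, ← sub_smul]
    congr 1
    rw [Nat.factorial_succ (m + 1)]
    push_cast
    field_simp
    ring
  rw [h4.tsum_eq, hRz]
  ring

variable {d : ℕ} {lam : Fin d → ℝ} {u : Fin d → B}


theorem key_sq (hl : ∀ r, 0 < lam r) (hu : ∀ r, ‖u r‖ ≤ 1) {ι : Type*} (S : Finset ι) (a : ι → Fin d → ℝ) :
    ‖(∏ j ∈ S, (∑ r, a j r • (u r - 1)) ^ 2) * NormedSpace.exp (∑ r, lam r • (u r - 1))‖ ≤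
      Real.sqrt ((2 * S.card).factorial : ℝ) * ∏ j ∈ S, ∑ r, a j r ^ 2 / lam r := by
  have := key_estimate hl hu ((S.toList ++ S.toList).map a)
  have hp : 0 ≤ ∏ j ∈ S, ∑ r, a j r ^ 2 / lam r :=
    Finset.prod_nonneg fun j _ => Finset.sum_nonneg fun r _ => by have := hl r; positivity
  simp only [List.map_map, List.map_append, List.prod_append,
    List.length_map, List.length_append, Finset.length_toList, Finset.prod_map_toList, ← two_mul] at this
  rw [Real.sqrt_mul (by positivity)] at this
  simp only [Function.comp] at this
  rw [Real.sqrt_mul_self hp] at this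
  rw [Finset.prod_pow, sq]
  exact this

theorem key_sum (hl : ∀ r, 0 < lam r) (hu : ∀ r, ‖u r‖ ≤ 1) {ι : Type*} [DecidableEq ι] (J : Finset ι) (a : ι → Fin d → ℝ) (C : ι → B) (c : ι → ℝ)
    (hC : ∀ j, ‖C j‖ ≤ c j) :
    ‖(∏ j ∈ J, ((∑ r, a j r • (u r - 1)) ^ 2 + C j)) * NormedSpace.exp (∑ r, lam r • (u r - 1))‖ ≤
      Real.sqrt ((2 * J.card).factorial : ℝ) *
        ∏ j ∈ J, ((∑ r, a j r ^ 2 / lam r) + c j / Real.sqrt 2) := by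
  rw [Finset.prod_add, Finset.prod_add, Finset.sum_mul, Finset.mul_sum]
  refine (norm_sum_le _ _).trans (Finset.sum_le_sum fun S hS => ?_)
  have hSJ := Finset.mem_powerset.mp hS
  have hc : ∀ j, 0 ≤ c j := fun j => (norm_nonneg _).trans (hC j)
  have hn : ∀ j, 0 ≤ ∑ r, a j r ^ 2 / lam r :=
    fun j => Finset.sum_nonneg fun r _ => by have := hl r; positivity
  have e1 : ∀ X Y Z : B, X * Y * Z = (X * Z) * Y := fun X Y Z => by ring
  rw [e1]
  refine (norm_mul_le _ _).trans ?_
  have h1 := key_sq hl hu S a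
  have h2 : ‖∏ j ∈ J \ S, C j‖ ≤ ∏ j ∈ J \ S, c j :=
    (Finset.norm_prod_le _ _).trans (Finset.prod_le_prod (fun _ _ => norm_nonneg _) fun j _ => hC j)
  refine (mul_le_mul h1 h2 (norm_nonneg _) ?_).trans ?_
  · exact mul_nonneg (Real.sqrt_nonneg _) (Finset.prod_nonneg fun j _ => hn j)
  rw [Finset.prod_div_distrib, Finset.prod_const]
  have hcard : S.card + (J \ S).card = J.card := by
    rw [add_comm]; exact Finset.card_sdiff_add_card_eq_card hSJ
  have h3 : Real.sqrt ((2 * S.card).factorial : ℝ) * Real.sqrt 2 ^ (J \ S).card ≤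
      Real.sqrt ((2 * J.card).factorial : ℝ) := by
    have : Real.sqrt 2 ^ (J \ S).card = Real.sqrt (2 ^ (J \ S).card) := by
      rw [Real.sqrt_eq_rpow, Real.sqrt_eq_rpow, ← Real.rpow_natCast, ← Real.rpow_natCast, ← Real.rpow_mul (by norm_num), ← Real.rpow_mul (by norm_num), mul_comm]
    rw [this, ← Real.sqrt_mul (by positivity)]
    apply Real.sqrt_le_sqrt
    have := fact_two S.card (J \ S).card
    rw [hcard] at this
    exact_mod_cast this
  have hP : 0 ≤ (∏ j ∈ S, ∑ r, a j r ^ 2 / lam r) * ((∏ j ∈ J \ S, c j) / Real.sqrt 2 ^ (J \ S).card) :=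
    mul_nonneg (Finset.prod_nonneg fun j _ => hn j)
      (div_nonneg (Finset.prod_nonneg fun j _ => hc j) (by positivity))
  refine le_trans (le_of_eq ?_) (mul_le_mul_of_nonneg_right h3 hP)
  have : Real.sqrt 2 ^ (J \ S).card ≠ 0 := by positivity
  field_simp

end AbsPart
end PaperAux

namespace PaperAux
open PaperL1
section AbsFinal
variable {B : Type*} [NormedCommRing B] [NormedAlgebra ℝ B] [CompleteSpace B] [NormOneClass B]

theorem norm_comb {d : ℕ} {u : Fin d → B} (hu : ∀ r, ‖u r‖ ≤ 1) (a : Fin d → ℝ) (ha : ∀ r, 0 ≤ a r) :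
    ‖∑ r, a r • (u r - 1)‖ ≤ 2 * ∑ r, a r := by
  rw [Finset.mul_sum]
  refine (norm_sum_le _ _).trans (Finset.sum_le_sum fun r _ => ?_)
  rw [norm_smul, Real.norm_of_nonneg (ha r), mul_comm]
  apply mul_le_mul_of_nonneg_right _ (ha r)
  refine (norm_sub_le _ _).trans ?_
  rw [norm_one]
  linarith [hu r]

theorem sthree : (2:ℝ) ^ ((3:ℝ)/2) = 2 * Real.sqrt 2 := by
  rw [show (3:ℝ)/2 = 1 + 1/2 by norm_num, Real.rpow_add (by norm_num), Real.rpow_one, Real.sqrt_eq_rpow]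

theorem split_R {d : ℕ} {lam : Fin d → ℝ} (hl : ∀ r, 0 < lam r) {u : Fin d → B} (hu : ∀ r, ‖u r‖ ≤ 1)
    (p : ℝ) (hp : 0 ≤ p) (q : Fin d → ℝ) (hq : ∀ r, 0 ≤ q r) (hq1 : ∑ r, q r = 1) :
    ∃ (a : Fin d → ℝ) (C : B) (c : ℝ), ‖C‖ ≤ c ∧
      (∑ r, (p * q r) • (u r - 1)) ^ 2 = (∑ r, a r • (u r - 1)) ^ 2 + C ∧
      (∑ r, a r ^ 2 / lam r) + c / Real.sqrt 2 =
        (2:ℝ) ^ ((3:ℝ)/2) * (p ^ 2 * ∑ r, q r * min (q r / ((2:ℝ) ^ ((3:ℝ)/2) * lam r)) 2) := by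
  set s := (2:ℝ) ^ ((3:ℝ)/2) with hs
  have hs0 : 0 < s := by positivity
  set a : Fin d → ℝ := fun r => if q r / (s * lam r) ≤ 2 then p * q r else 0 with ha
  set b : Fin d → ℝ := fun r => if q r / (s * lam r) ≤ 2 then 0 else p * q r with hb
  have ha0 : ∀ r, 0 ≤ a r := fun r => by
    simp only [ha]; split_ifs
    · exact mul_nonneg hp (hq r)
    · exact le_rfl
  have hb0 : ∀ r, 0 ≤ b r := fun r => by
    simp only [hb]; split_ifs
    · exact le_rfl
    · exact mul_nonneg hp (hq r)
  have hab : ∀ r, a r + b r = p * q r := fun r => by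
    simp only [ha, hb]; split_ifs <;> simp
  have hsum : ∑ r, a r + ∑ r, b r = p := by
    rw [← Finset.sum_add_distrib]
    simp_rw [hab]
    rw [← Finset.mul_sum, hq1, mul_one]
  have hnb : 0 ≤ ∑ r, b r := Finset.sum_nonneg fun r _ => hb0 r
  have hR : (∑ r, (p * q r) • (u r - 1)) = (∑ r, a r • (u r - 1)) + ∑ r, b r • (u r - 1) := by
    rw [← Finset.sum_add_distrib]
    simp_rw [← add_smul, hab]
  have n1 := norm_comb hu a ha0
  have n2 := norm_comb hu b hb0
  have n3 := norm_comb hu (fun r => p * q r) (fun r => mul_nonneg hp (hq r))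
  rw [← Finset.mul_sum, hq1, mul_one] at n3
  refine ⟨a, (∑ r, b r • (u r - 1)) * ((∑ r, (p * q r) • (u r - 1)) + ∑ r, a r • (u r - 1)),
    8 * p * ∑ r, b r, ?_, ?_, ?_⟩
  · refine (norm_mul_le _ _).trans ?_
    have n4 : ‖(∑ r, (p * q r) • (u r - 1)) + ∑ r, a r • (u r - 1)‖ ≤ 4 * p := by
      refine (norm_add_le _ _).trans ?_
      linarith
    calc _ ≤ (2 * ∑ r, b r) * (4 * p) := mul_le_mul n2 n4 (norm_nonneg _) (by positivity)
      _ = _ := by ring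
  · rw [hR]; ring
  · have h2 : Real.sqrt 2 * Real.sqrt 2 = 2 := Real.mul_self_sqrt (by norm_num)
    have h3 : 0 < Real.sqrt 2 := by positivity
    have h4 : (8:ℝ) / Real.sqrt 2 = 2 * s := by
      rw [hs, sthree]; field_simp; nlinarith
    rw [mul_div_right_comm, mul_div_right_comm, h4, Finset.mul_sum, ← Finset.sum_add_distrib, ← mul_assoc, Finset.mul_sum]
    apply Finset.sum_congr rfl
    intro r _
    have := hl r
    by_cases hc : q r / (s * lam r) ≤ 2
    · rw [min_eq_left hc]
      simp only [ha, hb, if_pos hc]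
      field_simp
      ring
    · rw [min_eq_right (not_le.mp hc).le]
      simp only [ha, hb, if_neg hc]
      ring

theorem abstract_bound {d n : ℕ} {lam : Fin d → ℝ} (hl : ∀ r, 0 < lam r) {u : Fin d → B}
    (hu : ∀ r, ‖u r‖ ≤ 1) (p : Fin n → ℝ) (hp : ∀ j, 0 ≤ p j) (q : Fin n → Fin d → ℝ)
    (hq : ∀ j r, 0 ≤ q j r) (hq1 : ∀ j, ∑ r, q j r = 1) (R : Fin n → B)
    (hR : ∀ j, R j = ∑ r, (p j * q j r) • (u r - 1)) (k : ℕ) :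
    ‖(∑ J ∈ Finset.powersetCard k Finset.univ, ∏ j ∈ J, ((1 + R j) * NormedSpace.exp (-R j) - 1)) *
      NormedSpace.exp (∑ r, lam r • (u r - 1))‖ ≤
     Real.sqrt ((2 * k).factorial : ℝ) / ((k.factorial : ℝ) * 2 ^ k) *
        ((2:ℝ) ^ ((3:ℝ)/2) * ∑ j, gfun (2 * p j) * (p j) ^ 2 *
      ∑ r, q j r * min (q j r / ((2:ℝ) ^ ((3:ℝ)/2) * lam r)) 2) ^ k := by
  choose a C c hC hsq hval using fun j => split_R hl hu (p j) (hp j) (q j) (hq j) (hq1 j)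
  have hRn : ∀ j, ‖R j‖ ≤ 2 * p j := by
    intro j
    have := norm_comb hu (fun r => p j * q j r) (fun r => mul_nonneg (hp j) (hq j r))
    rw [← Finset.mul_sum, hq1, mul_one] at this
    rw [hR]; exact this
  choose G hG hV using fun j => V_repr (R j) (2 * p j) (hRn j)
  set s := (2:ℝ) ^ ((3:ℝ)/2) with hs
  have hs0 : 0 < s := by positivity
  set w : Fin n → ℝ := fun j => p j ^ 2 * ∑ r, q j r * min (q j r / (s * lam r)) 2 with hw
  have hw0 : ∀ j, 0 ≤ w j := fun j => mul_nonneg (sq_nonneg _) (Finset.sum_nonneg fun r _ => by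
    have := hl r
    have := hq j r
    positivity)
  have hg0 : ∀ j, 0 ≤ gfun (2 * p j) := fun j => g_nonneg (by linarith [hp j])
  have hJ : ∀ J ∈ Finset.powersetCard k (Finset.univ : Finset (Fin n)),
      ‖(∏ j ∈ J, ((1 + R j) * NormedSpace.exp (-R j) - 1)) * NormedSpace.exp (∑ r, lam r • (u r - 1))‖
      ≤ (Real.sqrt ((2 * k).factorial : ℝ) / 2 ^ k) * ∏ j ∈ J, (s * (gfun (2 * p j) * w j)) := by
    intro J hJ
    have hk := (Finset.mem_powersetCard.mp hJ).2
    simp_rw [hV]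
    rw [Finset.prod_smul, Finset.prod_const, hk, Finset.prod_mul_distrib, smul_mul_assoc, norm_smul]
    have e1 : ∀ X Y Z : B, X * Y * Z = (X * Z) * Y := fun X Y Z => by ring
    rw [e1]
    have k1 := key_sum hl hu J a C c hC
    simp_rw [hval, ← hsq, ← hR] at k1
    rw [hk] at k1
    have k2 : ‖∏ j ∈ J, G j‖ ≤ ∏ j ∈ J, gfun (2 * p j) :=
      (Finset.norm_prod_le _ _).trans (Finset.prod_le_prod (fun _ _ => norm_nonneg _) fun j _ => hG j)
    have k3 := (norm_mul_le _ _).trans (mul_le_mul k1 k2 (norm_nonneg _)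
      (mul_nonneg (Real.sqrt_nonneg _) (Finset.prod_nonneg fun j _ => mul_nonneg hs0.le (hw0 j))))
    have k4 : ‖(-(1/2) : ℝ) ^ k‖ = 1 / 2 ^ k := by
      rw [norm_pow, norm_neg, Real.norm_of_nonneg (by norm_num)]; simp
    rw [k4]
    refine (mul_le_mul_of_nonneg_left k3 (by positivity)).trans (le_of_eq ?_)
    have k5 : ∏ j ∈ J, (s * (gfun (2 * p j) * w j)) = (∏ j ∈ J, s * w j) * ∏ j ∈ J, gfun (2 * p j) := by
      rw [← Finset.prod_mul_distrib]
      exact Finset.prod_congr rfl fun j _ => by ring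
    rw [k5]
    simp only [hw]
    ring
  rw [Finset.sum_mul]
  refine (norm_sum_le _ _).trans ((Finset.sum_le_sum hJ).trans ?_)
  rw [← Finset.mul_sum]
  have h5 := esymm_le (Finset.univ : Finset (Fin n)) (fun j => s * (gfun (2 * p j) * w j))
    (fun j => mul_nonneg hs0.le (mul_nonneg (hg0 j) (hw0 j))) k
  refine (mul_le_mul_of_nonneg_left h5 (by positivity)).trans (le_of_eq ?_)
  rw [← Finset.mul_sum]
  simp only [hw, ← mul_assoc]
  field_simp

end AbsFinal
end PaperAux

namespace PaperAux
open PaperL1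
section ConvPart
variable {X : Type*} [AddCommMonoid X]

theorem summable_pair {f g : X → ℝ} (hf : Summable f) (hg : Summable g) :
    Summable fun z : X × X => f z.1 * g z.2 :=
  summable_mul_of_summable_norm hf.norm hg.norm

theorem summable_bdd {ι : Type*} {f : ι → ℝ} (hf : Summable f) {φ : ι → ℝ} {K : ℝ} (hφ : ∀ x, |φ x| ≤ K) :
    Summable fun x => f x * φ x := by
  refine Summable.of_norm_bounded (hf.norm.mul_right K) (fun x => ?_)
  rw [norm_mul]
  exact mul_le_mul_of_nonneg_left (hφ x) (norm_nonneg _)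

theorem conv_pair {f g : X → ℝ} (hf : Summable f) (hg : Summable g) {φ : X → ℝ} {K : ℝ}
    (hφ : ∀ x, |φ x| ≤ K) :
    HasSum (fun x => conv f g x * φ x) (∑' y, f y * ∑' z, g z * φ (y + z)) := by
  have h0 : Summable fun z : X × X => (f z.1 * g z.2) * φ (z.1 + z.2) :=
    summable_bdd (summable_pair hf hg) (fun z => hφ _)
  have e1 : ∑' y, f y * ∑' z, g z * φ (y + z) = ∑' z : X × X, (f z.1 * g z.2) * φ (z.1 + z.2) := by
    rw [h0.tsum_prod' (fun y => h0.prod_factor y)]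
    apply tsum_congr; intro y
    rw [← tsum_mul_left]
    apply tsum_congr; intro z; ring
  rw [e1]
  have h1 := (Equiv.sigmaFiberEquiv (fun z : X × X => z.1 + z.2)).hasSum_iff.mpr h0.hasSum
  have h2 : ∀ x, HasSum (fun p : {p : X × X // p.1 + p.2 = x} => (f p.1.1 * g p.1.2) * φ x)
      (conv f g x * φ x) := by
    intro x
    apply HasSum.mul_right
    unfold conv
    apply Summable.hasSum
    exact (summable_pair hf hg).subtype {p : X × X | p.1 + p.2 = x}
  refine h1.sigma (fun x => (h2 x).congr_fun ?_)
  rintro ⟨p, hp⟩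
  simp [Equiv.sigmaFiberEquiv, hp]

/-- translation operator -/
def Top (f : X → ℝ) (φ : X → ℝ) : X → ℝ := fun y => ∑' z, f z * φ (y + z)

theorem Top_bdd {f : X → ℝ} (hf : Summable f) {φ : X → ℝ} {K : ℝ} (hφ : ∀ x, |φ x| ≤ K) (y : X) :
    |Top f φ y| ≤ (∑' x, |f x|) * K := by
  unfold Top
  have hs := summable_bdd hf (φ := fun z => φ (y + z)) (fun z => hφ _)
  rw [← Real.norm_eq_abs]
  refine (norm_tsum_le_tsum_norm hs.norm).trans ?_
  rw [← tsum_mul_right]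
  refine hs.norm.tsum_le_tsum (fun x => ?_) (hf.abs.mul_right K)
  rw [norm_mul]
  exact mul_le_mul_of_nonneg_left (hφ _) (norm_nonneg _)

theorem conv_summable {f g : X → ℝ} (hf : Summable f) (hg : Summable g) : Summable (conv f g) := by
  have := (conv_pair hf hg (φ := fun _ => 1) (K := 1) (fun _ => by simp)).summable
  simpa using this

theorem Top_conv {f g : X → ℝ} (hf : Summable f) (hg : Summable g) {φ : X → ℝ} {K : ℝ}
    (hφ : ∀ x, |φ x| ≤ K) : Top (conv f g) φ = Top f (Top g φ) := by
  ext y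
  have := (conv_pair hf hg (φ := fun z => φ (y + z)) (fun z => hφ _)).tsum_eq
  unfold Top
  rw [this]
  simp_rw [add_assoc]

theorem delta_bdd (x y : X) : |delta x y| ≤ 1 := by
  unfold delta; split_ifs <;> simp

theorem Top_delta (f : X → ℝ) (x : X) : Top f (delta x) 0 = f x := by
  unfold Top
  rw [tsum_eq_single x]
  · simp [delta]
  · intro y hy; simp [delta, hy]

theorem delta_summable (x : X) : Summable (delta x) := by
  apply summable_of_ne_finset_zero (s := {x})
  intro y hy
  simp at hy
  simp [delta, hy]

theorem Top_one (φ : X → ℝ) : Top (delta 0) φ = φ := by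
  ext y
  unfold Top
  rw [tsum_eq_single 0]
  · simp [delta]
  · intro z hz; simp [delta, hz]

theorem conv_comm' (f g : X → ℝ) : conv f g = conv g f := by
  ext x
  unfold conv
  let e : {p : X × X // p.1 + p.2 = x} ≃ {p : X × X // p.1 + p.2 = x} :=
    { toFun := fun p => ⟨(p.1.2, p.1.1), by rw [add_comm]; exact p.2⟩
      invFun := fun p => ⟨(p.1.2, p.1.1), by rw [add_comm]; exact p.2⟩
      left_inv := fun p => rfl
      right_inv := fun p => rfl }
  rw [← e.tsum_eq]
  apply tsum_congr
  intro p
  exact mul_comm _ _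

theorem conv_assoc' {f g h : X → ℝ} (hf : Summable f) (hg : Summable g) (hh : Summable h) :
    conv (conv f g) h = conv f (conv g h) := by
  ext x
  rw [← Top_delta (conv (conv f g) h), ← Top_delta (conv f (conv g h)),
    Top_conv (conv_summable hf hg) hh (delta_bdd x), Top_conv hf (conv_summable hg hh) (delta_bdd x),
    Top_conv hg hh (delta_bdd x), Top_conv hf hg (Top_bdd hh (delta_bdd x))]

theorem one_conv {f : X → ℝ} (hf : Summable f) : conv (delta 0) f = f := by
  ext x
  rw [← Top_delta (conv (delta 0) f), Top_conv (delta_summable 0) hf (delta_bdd x), Top_one, Top_delta]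

theorem conv_add {f g h : X → ℝ} (hf : Summable f) (hg : Summable g) (hh : Summable h) :
    conv f (g + h) = conv f g + conv f h := by
  ext x
  have h1 := (summable_pair hf hg).subtype {p : X × X | p.1 + p.2 = x}
  have h2 := (summable_pair hf hh).subtype {p : X × X | p.1 + p.2 = x}
  have h3 := h1.tsum_add h2
  rw [Pi.add_apply]
  unfold conv
  refine Eq.trans ?_ h3
  apply tsum_congr
  intro p
  simp [mul_add]

theorem smul_conv (c : ℝ) (f g : X → ℝ) : conv (c • f) g = c • conv f g := by
  ext x
  unfold conv
  rw [Pi.smul_apply, smul_eq_mul, ← tsum_mul_left]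
  apply tsum_congr; intro p; simp; ring

theorem conv_norm {f g : X → ℝ} (hf : Summable f) (hg : Summable g) :
    ∑' x, |conv f g x| ≤ (∑' x, |f x|) * ∑' x, |g x| := by
  have h1 := conv_pair hf.abs hg.abs (φ := fun _ => 1) (K := 1) (fun _ => by simp)
  simp only [mul_one] at h1
  rw [tsum_mul_right] at h1
  rw [← h1.tsum_eq]
  refine (conv_summable hf hg).abs.tsum_le_tsum (fun x => ?_) h1.summable
  unfold conv
  have h2 := (summable_pair hf hg).subtype {p : X × X | p.1 + p.2 = x}
  have h3 := norm_tsum_le_tsum_norm h2.norm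
  refine h3.trans (le_of_eq ?_)
  apply tsum_congr; intro p
  simp [abs_mul]

/-- The convolution algebra -/
def L1 (X : Type*) : Type _ := lp (fun _ : X => ℝ) 1

instance : NormedAddCommGroup (L1 X) := inferInstanceAs (NormedAddCommGroup (lp (fun _ : X => ℝ) 1))
instance : NormedSpace ℝ (L1 X) := inferInstanceAs (NormedSpace ℝ (lp (fun _ : X => ℝ) 1))
instance : CompleteSpace (L1 X) := inferInstanceAs (CompleteSpace (lp (fun _ : X => ℝ) 1))

/-- underlying function -/
def L1.fn (f : L1 X) : X → ℝ := fun x => (show lp (fun _ : X => ℝ) 1 from f) x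

theorem L1.ext' {f g : L1 X} (h : f.fn = g.fn) : f = g := lp.ext h

theorem L1.summable (f : L1 X) : Summable f.fn := by
  have := (memℓp_gen_iff (p := 1) (by simp)).mp (lp.memℓp (show lp (fun _ : X => ℝ) 1 from f))
  simp only [ENNReal.toReal_one, Real.rpow_one] at this
  exact Summable.of_norm this

theorem L1.norm_def (f : L1 X) : ‖f‖ = ∑' x, |f.fn x| := by
  have := lp.norm_eq_tsum_rpow (p := 1) (by simp) (show lp (fun _ : X => ℝ) 1 from f)
  simp at this
  exact this

/-- constructor -/
def L1.mk (f : X → ℝ) (hf : Summable f) : L1 X :=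
  (⟨f, memℓp_gen (by simpa using hf.abs)⟩ : lp (fun _ : X => ℝ) 1)

theorem L1.fn_mk (f : X → ℝ) (hf : Summable f) : (L1.mk f hf).fn = f := rfl
theorem L1.fn_add (f g : L1 X) : (f + g).fn = f.fn + g.fn := rfl
theorem L1.fn_sub (f g : L1 X) : (f - g).fn = f.fn - g.fn := rfl
theorem L1.fn_neg (f : L1 X) : (-f).fn = -f.fn := rfl
theorem L1.fn_zero : (0 : L1 X).fn = 0 := rfl
theorem L1.fn_smul (c : ℝ) (f : L1 X) : (c • f).fn = c • f.fn := rfl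

instance : Mul (L1 X) := ⟨fun f g => L1.mk (conv f.fn g.fn) (conv_summable f.summable g.summable)⟩
instance : One (L1 X) := ⟨L1.mk (delta 0) (delta_summable 0)⟩

theorem L1.fn_mul (f g : L1 X) : (f * g).fn = conv f.fn g.fn := rfl
theorem L1.fn_one : (1 : L1 X).fn = delta 0 := rfl

theorem L1.mul_comm' (f g : L1 X) : f * g = g * f := L1.ext' (conv_comm' _ _)
theorem L1.one_mul' (f : L1 X) : 1 * f = f := L1.ext' (one_conv f.summable)
theorem L1.mul_add' (f g h : L1 X) : f * (g + h) = f * g + f * h :=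
  L1.ext' (conv_add f.summable g.summable h.summable)
theorem L1.zero_mul' (f : L1 X) : 0 * f = 0 := L1.ext' (by
  rw [L1.fn_mul, L1.fn_zero]; ext x; simp [conv])

instance : NormedCommRing (L1 X) :=
  { (inferInstance : NormedAddCommGroup (L1 X)) with
    mul_comm := L1.mul_comm'
    mul_assoc := fun f g h => L1.ext' (conv_assoc' f.summable g.summable h.summable)
    one_mul := L1.one_mul'
    mul_one := fun f => by rw [L1.mul_comm', L1.one_mul']
    left_distrib := L1.mul_add'
    right_distrib := fun f g h => by
      rw [L1.mul_comm', L1.mul_add', L1.mul_comm' h f, L1.mul_comm' h g]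
    zero_mul := L1.zero_mul'
    mul_zero := fun f => by rw [L1.mul_comm', L1.zero_mul']
    norm_mul_le := fun f g => by
      rw [L1.norm_def, L1.norm_def, L1.norm_def]
      exact conv_norm f.summable g.summable }

theorem L1.smul_mul' (c : ℝ) (f g : L1 X) : (c • f) * g = c • (f * g) := L1.ext' (smul_conv c _ _)

instance : Algebra ℝ (L1 X) :=
  Algebra.ofModule L1.smul_mul' (fun c f g => by rw [mul_comm, L1.smul_mul', mul_comm])

instance : NormedAlgebra ℝ (L1 X) where
  norm_smul_le c f := norm_smul_le c f

instance : NormOneClass (L1 X) where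
  norm_one := by
    rw [L1.norm_def, L1.fn_one, tsum_eq_single 0]
    · simp [delta]
    · intro y hy; simp [delta, hy]

theorem L1.fn_sum {ι : Type*} (s : Finset ι) (f : ι → L1 X) : (∑ i ∈ s, f i).fn = ∑ i ∈ s, (f i).fn := by
  induction s using Finset.induction_on with
  | empty => simp [L1.fn_zero]
  | insert a s ha ih => rw [Finset.sum_insert ha, Finset.sum_insert ha, L1.fn_add, ih]

theorem L1.fn_pow (f : L1 X) (m : ℕ) : (f ^ m).fn = convPow f.fn m := by
  induction m with
  | zero => rw [pow_zero]; rfl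
  | succ m ih => rw [pow_succ', L1.fn_mul, ih]; rfl

theorem L1.fn_prod {ι : Type*} [LinearOrder ι] (s : Finset ι) (f : ι → L1 X) :
    (∏ i ∈ s, f i).fn = convProd s (fun i => (f i).fn) := by
  have h : ∀ l : List ι, (l.map f).prod.fn = l.foldr (fun i acc => conv ((f i).fn) acc) (delta 0) := by
    intro l
    induction l with
    | nil => rfl
    | cons a l ih => rw [List.map_cons, List.prod_cons, L1.fn_mul, ih]; rfl
  unfold convProd
  rw [← h]
  congr 1
  rw [← Multiset.prod_coe, ← Multiset.map_coe, Finset.sort_eq]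
  rfl

theorem L1.fn_exp (f : L1 X) : (NormedSpace.exp f).fn = convExp f.fn := by
  ext x
  have h := NormedSpace.exp_series_hasSum_exp' (𝕂 := ℝ) f
  let ev : L1 X →ₗ[ℝ] ℝ :=
    { toFun := fun g => g.fn x
      map_add' := fun g h => rfl
      map_smul' := fun c g => rfl }
  have hb : ∀ g : L1 X, ‖ev g‖ ≤ 1 * ‖g‖ := by
    intro g
    rw [one_mul]
    exact lp.norm_apply_le_norm (p := 1) (by simp) (show lp (fun _ : X => ℝ) 1 from g) x
  have h2 := (ev.mkContinuous 1 hb).hasSum h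
  have h3 := h2.tsum_eq
  unfold convExp
  refine h3.symm.trans ?_
  apply tsum_congr
  intro m
  rw [← L1.fn_pow]
  rfl

end ConvPart
end PaperAux

open PaperL1

/-- The key estimate in the proof of Theorem 2 of Roos: for `k ∈ {1,…,n}`,
`‖H_k‖ ≤ (√((2k)!)/(k! 2^k)) (2^{3/2} α₁)^k`. -/
theorem compound_poisson_Hk_norm_bound
    {X : Type*} [AddCommMonoid X] [Countable X]
    (d n : ℕ) (hd : 1 ≤ d) (hn : 1 ≤ n)
    (p : Fin n → ℝ) (q : Fin n → Fin d → ℝ)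
    (hp : ∀ j, p j ∈ Set.Icc (0:ℝ) 1)
    (hq : ∀ j r, q j r ∈ Set.Icc (0:ℝ) 1)
    (hq1 : ∀ j, ∑ r, q j r = 1)
    (lam : Fin d → ℝ) (hlam : ∀ r, lam r = ∑ j, p j * q j r)
    (hlampos : ∀ r, 0 < lam r)
    (U : Fin d → X → ℝ) (hU : ∀ r, IsPmf (U r))
    (Q : Fin n → X → ℝ) (hQ : ∀ j, Q j = ∑ r, q j r • U r)
    (lamtot : ℝ) (hlamtot : lamtot = ∑ j, p j)
    (Qbar : X → ℝ) (hQbar : Qbar = lamtot⁻¹ • ∑ j, p j • Q j)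
    (R : Fin n → X → ℝ) (hR : ∀ j, R j = p j • (Q j - delta 0))
    (Fj : Fin n → X → ℝ) (hFj : ∀ j, Fj j = delta 0 + R j)
    (V : Fin n → X → ℝ) (hV : ∀ j, V j = conv (Fj j) (convExp (-(R j))) - delta 0)
    (F : X → ℝ) (hF : F = convProd Finset.univ Fj)
    (M : ℕ → X → ℝ)
    (hM : ∀ k, M k = ∑ J ∈ Finset.powersetCard k Finset.univ, convProd J V)
    (H : ℕ → X → ℝ)
    (hH : ∀ k, H k = conv (M k) (convExp (lamtot • (Qbar - delta 0))))
    (k : ℕ) (hk1 : 1 ≤ k) (hkn : k ≤ n)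
    (α₁ : ℝ)
    (hα₁ : α₁ = ∑ j, gfun (2 * p j) * (p j) ^ 2 *
      ∑ r, q j r * min (q j r / ((2:ℝ) ^ ((3:ℝ)/2) * lam r)) 2) :
    l1norm (H k) ≤
      Real.sqrt ((2 * k).factorial : ℝ) / ((k.factorial : ℝ) * 2 ^ k) *
        ((2:ℝ) ^ ((3:ℝ)/2) * α₁) ^ k := by
  set u : Fin d → PaperAux.L1 X := fun r => PaperAux.L1.mk (U r) (hU r).2.summable with hu
  have hun : ∀ r, ‖u r‖ ≤ 1 := by
    intro r
    rw [PaperAux.L1.norm_def]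
    have h1 : ∀ x, |(u r).fn x| = U r x := fun x => abs_of_nonneg ((hU r).1 x)
    simp_rw [h1]
    exact (hU r).2.tsum_eq.le
  have hufn : ∀ r, (u r).fn = U r := fun r => rfl
  set R' : Fin n → PaperAux.L1 X := fun j => ∑ r, (p j * q j r) • (u r - 1) with hR'
  have hRfn : ∀ j, R j = (R' j).fn := by
    intro j
    rw [hR, hQ, hR', PaperAux.L1.fn_sum]
    simp only [PaperAux.L1.fn_smul, PaperAux.L1.fn_sub, PaperAux.L1.fn_one, hufn]
    ext x
    simp only [Pi.smul_apply, Pi.sub_apply, Finset.sum_apply, smul_eq_mul]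
    have h2 : delta (0:X) x = ∑ r, q j r * delta (0:X) x := by
      rw [← Finset.sum_mul, hq1, one_mul]
    rw [h2, ← Finset.sum_sub_distrib, Finset.mul_sum, ← h2]
    exact Finset.sum_congr rfl (fun r _ => by ring)
  have hVfn : V = fun j => ((1 + R' j) * NormedSpace.exp (-R' j) - 1).fn := by
    funext j
    rw [hV, hFj, hRfn, PaperAux.L1.fn_sub, PaperAux.L1.fn_mul, PaperAux.L1.fn_add,
      PaperAux.L1.fn_exp, PaperAux.L1.fn_neg, PaperAux.L1.fn_one]
  have hMfn : M k = (∑ J ∈ Finset.powersetCard k Finset.univ,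
      ∏ j ∈ J, ((1 + R' j) * NormedSpace.exp (-R' j) - 1)).fn := by
    rw [hM, PaperAux.L1.fn_sum]
    refine Finset.sum_congr rfl (fun J _ => ?_)
    rw [PaperAux.L1.fn_prod, hVfn]
  have htot : lamtot = ∑ r, lam r := by
    rw [hlamtot]
    simp_rw [hlam]
    rw [Finset.sum_comm]
    refine Finset.sum_congr rfl (fun j _ => ?_)
    rw [← Finset.mul_sum, hq1, mul_one]
  have htot0 : lamtot ≠ 0 := by
    rw [htot]
    haveI : Nonempty (Fin d) := ⟨⟨0, hd⟩⟩
    exact (Finset.sum_pos (fun r _ => hlampos r) Finset.univ_nonempty).ne'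
  have hEfn : lamtot • (Qbar - delta 0) = (∑ r, lam r • (u r - 1)).fn := by
    rw [hQbar, smul_sub, smul_smul, mul_inv_cancel₀ htot0, one_smul, PaperAux.L1.fn_sum]
    simp only [PaperAux.L1.fn_smul, PaperAux.L1.fn_sub, PaperAux.L1.fn_one, hufn, hQ]
    simp_rw [smul_sub]
    rw [Finset.sum_sub_distrib, ← Finset.sum_smul, ← htot]
    congr 1
    simp_rw [Finset.smul_sum, smul_smul]
    rw [Finset.sum_comm]
    refine Finset.sum_congr rfl (fun r _ => ?_)
    rw [← Finset.sum_smul, ← hlam]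
  have hfin : l1norm (H k) = ‖(∑ J ∈ Finset.powersetCard k Finset.univ,
      ∏ j ∈ J, ((1 + R' j) * NormedSpace.exp (-R' j) - 1)) *
      NormedSpace.exp (∑ r, lam r • (u r - 1))‖ := by
    rw [PaperAux.L1.norm_def, PaperAux.L1.fn_mul, PaperAux.L1.fn_exp, ← hEfn, ← hMfn, ← hH]
    rfl
  rw [hfin, hα₁]
  exact PaperAux.abstract_bound hlampos hun p (fun j => (hp j).1) q (fun j r => (hq j r).1) hq1 R'
    (fun j => rfl) k
end
end

section
/- Let X be a countable commutative additive monoid, d, k ≥ 1 integers, p_{j,r} ∈ ℝ for j ∈ {1,…,k}, r ∈ {1,…,d}, and λ_1,…,λ_d ∈ (0,∞). For r ∈ {1,…,d}, let U_r be probability mass functions in ℓ¹(X) and W_r = U_r − δ₀. Set R_j = Σ_{r=1}^d p_{j,r} W_r for j ∈ {1,…,k}, and G = exp(Σ_{r=1}^d λ_r W_r). Then ‖ (∏_{j=1}^k R_j) * G ‖ ≤ ( (1/k!) Σ_{r∈{1,…,d}^k} ( Σ_{σ ∈ S_k} ∏_{j=1}^k p_{j, r_{σ(j)}} / √(λ_{r_{σ(j)}})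 )² )^{1/2} ≤ √(k!) · ∏_{j=1}^k ( Σ_{r=1}^d p_{j,r}²/λ_r )^{1/2}, where S_k denotes the set of permutations of {1,…,k}. -/
open scoped Classical BigOperators

noncomputable section

open PaperL1

set_option linter.unusedSectionVars false


namespace PaperL1

section L1
variable {X : Type*} [AddCommMonoid X]

lemma summable_mul_prod {f g : X → ℝ} (hf : Summable f) (hg : Summable g) :
    Summable (fun q : X × X => f q.1 * g q.2) :=
  Summable.of_norm (Summable.mul_norm hf.norm hg.norm)

/-- Regroup a sum over pairs along the fibres of addition. -/
lemma hasSum_fiber {F : X × X → ℝ} (hF : Summable F) :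
    HasSum (fun x => ∑' q : {q : X × X // q.1 + q.2 = x}, F q.1) (∑' q, F q) := by
  have h2 : HasSum (F ∘ (Equiv.sigmaFiberEquiv (fun q : X × X => q.1 + q.2))) (∑' q, F q) :=
    (Equiv.hasSum_iff _).2 hF.hasSum
  exact h2.sigma (fun x => (h2.summable.sigma_factor x).hasSum)

lemma summable_abs_conv {f g : X → ℝ} (hf : Summable f) (hg : Summable g) :
    Summable (fun x => |conv f g x|) ∧
      ∑' x, |conv f g x| ≤ (∑' x, |f x|) * ∑' x, |g x| := by
  have hs := summable_mul_prod hf hg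
  have h1 := hasSum_fiber hs.abs
  have hle : ∀ x, |conv f g x| ≤
      ∑' q : {q : X × X // q.1 + q.2 = x}, |f q.1.1 * g q.1.2| := fun x => by
    have := norm_tsum_le_tsum_norm
      (f := fun q : {q : X × X // q.1 + q.2 = x} => f q.1.1 * g q.1.2)
      (hs.norm.subtype {q : X × X | q.1 + q.2 = x})
    simpa [conv, Real.norm_eq_abs] using this
  have hsum : Summable (fun x => |conv f g x|) :=
    Summable.of_nonneg_of_le (fun _ => abs_nonneg _) hle h1.summable
  refine ⟨hsum, ?_⟩
  calc _ ≤ _ := hsum.tsum_le_tsum hle h1.summable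
    _ = ∑' q : X × X, |f q.1 * g q.2| := h1.tsum_eq
    _ = ∑' q : X × X, |f q.1| * |g q.2| := by simp [abs_mul]
    _ = _ := (hf.abs.tsum_mul_tsum hg.abs (summable_mul_prod hf.abs hg.abs)).symm

lemma summable_conv {f g : X → ℝ} (hf : Summable f) (hg : Summable g) :
    Summable (conv f g) := (summable_abs_conv hf hg).1.of_abs

/-- Pairing a convolution with a bounded function. -/
lemma tsum_conv_mul {f g : X → ℝ} (hf : Summable f) (hg : Summable g)
    (φ : X → ℝ) (C : ℝ) (hφ : ∀ x, |φ x| ≤ C) :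
    ∑' x, conv f g x * φ x = ∑' y, f y * ∑' z, g z * φ (y + z) := by
  have hs := summable_mul_prod hf hg
  have hs2 : Summable (fun q : X × X => f q.1 * g q.2 * φ (q.1 + q.2)) := by
    refine Summable.of_norm_bounded (hs.abs.mul_right C) (fun q => ?_)
    rw [Real.norm_eq_abs, abs_mul]
    exact mul_le_mul_of_nonneg_left (hφ _) (abs_nonneg _)
  have h1 := (hasSum_fiber hs2).tsum_eq
  rw [hs2.tsum_prod] at h1
  calc _ = _ := tsum_congr (fun x => ?_)
    _ = _ := h1
    _ = _ := tsum_congr (fun y => by rw [← tsum_mul_left]; simp only [mul_assoc])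
  rw [conv, ← tsum_mul_right]
  exact tsum_congr (fun q => by rw [q.2])

lemma eq_of_pairing {f g : X → ℝ}
    (h : ∀ φ : X → ℝ, (∀ x, |φ x| ≤ 1) → ∑' x, f x * φ x = ∑' x, g x * φ x) : f = g := by
  funext a
  have := h (fun x => if x = a then 1 else 0) (fun x => by split_ifs <;> simp)
  simpa using this

lemma conv_comm' (f g : X → ℝ) : conv f g = conv g f := by
  funext x
  let e : {q : X × X // q.1 + q.2 = x} ≃ {q : X × X // q.1 + q.2 = x} :=
    (Equiv.prodComm X X).subtypeEquiv (fun q => by simp [add_comm])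
  unfold conv
  rw [← e.tsum_eq]
  exact tsum_congr (fun q => mul_comm _ _)

lemma conv_assoc' {f g h : X → ℝ} (hf : Summable f) (hg : Summable g) (hh : Summable h) :
    conv (conv f g) h = conv f (conv g h) := by
  refine eq_of_pairing (fun φ hφ => ?_)
  have hb : ∀ u, |∑' z, h z * φ (u + z)| ≤ ∑' z, |h z| := fun u => by
    have hle : ∀ z, |h z * φ (u + z)| ≤ |h z| := fun z => by
      rw [abs_mul]; exact mul_le_of_le_one_right (abs_nonneg _) (hφ _)
    have hs : Summable (fun z => |h z * φ (u + z)|) :=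
      Summable.of_nonneg_of_le (fun _ => abs_nonneg _) hle hh.abs
    have h1 : |∑' z, h z * φ (u + z)| ≤ ∑' z, |h z * φ (u + z)| := by
      simpa only [Real.norm_eq_abs] using
        norm_tsum_le_tsum_norm (f := fun z => h z * φ (u + z)) (by simpa only [Real.norm_eq_abs] using hs)
    exact h1.trans (hs.tsum_le_tsum hle hh.abs)
  have e1 := tsum_conv_mul (summable_conv hf hg) hh φ 1 hφ
  have e2 := tsum_conv_mul hf hg (fun u => ∑' z, h z * φ (u + z)) (∑' z, |h z|) hb
  have e3 := tsum_conv_mul hf (summable_conv hg hh) φ 1 hφ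
  refine e1.trans (e2.trans (Eq.trans ?_ e3.symm))
  refine tsum_congr (fun y => ?_)
  rw [tsum_conv_mul hg hh (fun v => φ (y + v)) 1 (fun v => hφ _)]
  simp only [add_assoc]

lemma conv_add' {f g h : X → ℝ} (hf : Summable f) (hg : Summable g) (hh : Summable h) :
    conv f (g + h) = conv f g + conv f h := by
  funext x
  simp only [conv, Pi.add_apply, mul_add]
  exact Summable.tsum_add ((summable_mul_prod hf hg).subtype {q : X × X | q.1 + q.2 = x})
    ((summable_mul_prod hf hh).subtype {q : X × X | q.1 + q.2 = x})

lemma conv_smul' (c : ℝ) (f g : X → ℝ) : conv (c • f) g = c • conv f g := by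
  funext x
  simp only [conv, Pi.smul_apply, smul_eq_mul, mul_assoc, tsum_mul_left]

lemma summable_delta : Summable (delta (0 : X)) :=
  (hasSum_ite_eq (0 : X) (1 : ℝ)).summable

lemma delta_conv {f : X → ℝ} (hf : Summable f) : conv (delta 0) f = f := by
  refine eq_of_pairing (fun φ hφ => ?_)
  rw [tsum_conv_mul summable_delta hf φ 1 hφ]
  simp [delta]

/-- The space of absolutely summable functions. -/
def L1 (X : Type*) : Type _ := lp (fun _ : X => ℝ) 1

namespace L1

instance : NormedAddCommGroup (L1 X) := inferInstanceAs (NormedAddCommGroup (lp (fun _ : X => ℝ) 1))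
instance : NormedSpace ℝ (L1 X) := inferInstanceAs (NormedSpace ℝ (lp (fun _ : X => ℝ) 1))
instance : CompleteSpace (L1 X) := inferInstanceAs (CompleteSpace (lp (fun _ : X => ℝ) 1))

/-- The underlying function. -/
def fn (a : L1 X) : X → ℝ := fun x => (show lp (fun _ : X => ℝ) 1 from a) x

lemma fn_injective {a b : L1 X} (h : a.fn = b.fn) : a = b := lp.ext h

lemma summable (a : L1 X) : Summable a.fn := by
  have := (memℓp_gen_iff (p := 1) (by norm_num)).1 (lp.memℓp (show lp (fun _ : X => ℝ) 1 from a))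
  simp only [ENNReal.toReal_one, Real.rpow_one] at this
  exact this.of_norm

/-- Build an element from a summable function. -/
def mk (f : X → ℝ) (hf : Summable f) : L1 X :=
  (⟨f, memℓp_gen (by simpa using hf.abs)⟩ : lp (fun _ : X => ℝ) 1)

@[simp] lemma fn_mk (f : X → ℝ) (hf : Summable f) : (mk f hf).fn = f := rfl
@[simp] lemma fn_add (a b : L1 X) : (a + b).fn = a.fn + b.fn := rfl
@[simp] lemma fn_sub (a b : L1 X) : (a - b).fn = a.fn - b.fn := rfl
@[simp] lemma fn_zero : (0 : L1 X).fn = 0 := rfl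
@[simp] lemma fn_smul (c : ℝ) (a : L1 X) : (c • a).fn = c • a.fn := rfl

lemma norm_eq (a : L1 X) : ‖a‖ = ∑' x, |a.fn x| := by
  have := lp.norm_eq_tsum_rpow (p := 1) (by norm_num) (show lp (fun _ : X => ℝ) 1 from a)
  simp only [ENNReal.toReal_one, Real.rpow_one, div_one] at this
  exact this

/-- Evaluation as a continuous linear map. -/
def ev (x : X) : L1 X →L[ℝ] ℝ := lp.evalCLM ℝ (fun _ : X => ℝ) 1 x

lemma ev_apply (x : X) (a : L1 X) : ev x a = a.fn x := rfl

lemma fn_sum {ι : Type*} (s : Finset ι) (a : ι → L1 X) : (∑ i ∈ s, a i).fn = ∑ i ∈ s, (a i).fn := by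
  funext x
  rw [← ev_apply, map_sum, Finset.sum_apply]
  rfl

instance : Mul (L1 X) := ⟨fun a b => mk (conv a.fn b.fn) (summable_conv a.summable b.summable)⟩
instance : One (L1 X) := ⟨mk (delta 0) summable_delta⟩

@[simp] lemma fn_mul (a b : L1 X) : (a * b).fn = conv a.fn b.fn := rfl
@[simp] lemma fn_one : (1 : L1 X).fn = delta 0 := rfl

lemma mul_comm' (a b : L1 X) : a * b = b * a := fn_injective (conv_comm' _ _)
lemma mul_add' (a b c : L1 X) : a * (b + c) = a * b + a * c :=
  fn_injective (conv_add' a.summable b.summable c.summable)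
lemma one_mul' (a : L1 X) : 1 * a = a := fn_injective (delta_conv a.summable)
lemma smul_mul' (c : ℝ) (a b : L1 X) : (c • a) * b = c • (a * b) :=
  fn_injective (conv_smul' c _ _)
lemma zero_mul' (a : L1 X) : 0 * a = 0 := by
  have := smul_mul' 0 0 a
  simpa using this

instance : NormedCommRing (L1 X) :=
  { (inferInstance : NormedAddCommGroup (L1 X)) with
    mul_assoc := fun a b c => fn_injective (conv_assoc' a.summable b.summable c.summable)
    mul_comm := mul_comm'
    left_distrib := mul_add'
    right_distrib := fun a b c => by rw [mul_comm', mul_add', mul_comm' c a, mul_comm' c b]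
    one_mul := one_mul'
    mul_one := fun a => by rw [mul_comm', one_mul']
    zero_mul := zero_mul'
    mul_zero := fun a => by rw [mul_comm', zero_mul']
    norm_mul_le := fun a b => by
      rw [norm_eq, norm_eq, norm_eq]
      exact (summable_abs_conv a.summable b.summable).2 }

instance : NormedAlgebra ℝ (L1 X) :=
  { Algebra.ofModule (R := ℝ) (A := L1 X) smul_mul'
      (fun c a b => by rw [mul_comm a, smul_mul', mul_comm a]) with
    norm_smul_le := fun c a => norm_smul_le c a }

lemma norm_of_pmf {f : X → ℝ} (hf : IsPmf f) : ‖mk f hf.2.summable‖ = 1 := by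
  rw [norm_eq, fn_mk]
  simp only [abs_of_nonneg (hf.1 _)]
  exact hf.2.tsum_eq

lemma norm_one' : ‖(1 : L1 X)‖ = 1 :=
  norm_of_pmf (f := delta (0 : X)) ⟨fun x => by unfold delta; split_ifs <;> norm_num,
    hasSum_ite_eq (0 : X) (1 : ℝ)⟩

instance : NormOneClass (L1 X) := ⟨norm_one'⟩

lemma fn_pow (a : L1 X) (n : ℕ) : (a ^ n).fn = convPow a.fn n := by
  induction n with
  | zero => rw [pow_zero]; rfl
  | succ n ih => rw [pow_succ', fn_mul, ih]; rfl

lemma fn_exp (a : L1 X) : (NormedSpace.exp a).fn = convExp a.fn := by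
  funext x
  have h := (NormedSpace.exp_series_hasSum_exp' (𝕂 := ℝ) a).mapL (ev x)
  rw [← ev_apply, ← h.tsum_eq]
  refine tsum_congr (fun m => ?_)
  rw [map_smul, ev_apply, fn_pow, smul_eq_mul]

lemma fn_prod {k : ℕ} (a : Fin k → L1 X) :
    (∏ j, a j).fn = convProd Finset.univ (fun j => (a j).fn) := by
  have h : ∀ l : List (Fin k), (l.map a).prod.fn =
      l.foldr (fun i acc => conv (a i).fn acc) (delta 0) := by
    intro l
    induction l with
    | nil => rfl
    | cons i l ih => rw [List.map_cons, List.prod_cons, fn_mul, ih]; rfl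
  unfold convProd
  rw [← h, ← Finset.prod_map_toList]
  congr 1
  exact ((Finset.sort_perm_toList _ _).symm.map a).prod_eq

end L1
end L1
end PaperL1

namespace PaperL1
section Comb

/-- Permutation of `Fin (k+1)` from its value at `0` and a permutation of `Fin k`. -/
def permCons {k : ℕ} (x : Fin (k + 1) × Equiv.Perm (Fin k)) : Equiv.Perm (Fin (k + 1)) :=
  Equiv.ofBijective (Fin.cons x.1 (fun j => x.1.succAbove (x.2 j)) : Fin (k + 1) → Fin (k + 1))
    (Finite.injective_iff_bijective.1 (by
      rw [Fin.cons_injective_iff]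
      refine ⟨?_, fun a b h => x.2.injective (Fin.succAbove_right_injective h)⟩
      rintro ⟨j, hj⟩
      exact Fin.succAbove_ne _ _ hj))

lemma permCons_zero {k : ℕ} (x : Fin (k + 1) × Equiv.Perm (Fin k)) : permCons x 0 = x.1 := rfl
lemma permCons_succ {k : ℕ} (x : Fin (k + 1) × Equiv.Perm (Fin k)) (j : Fin k) :
    permCons x j.succ = x.1.succAbove (x.2 j) := rfl

lemma permCons_bijective {k : ℕ} : Function.Bijective (permCons (k := k)) := by
  rw [Fintype.bijective_iff_injective_and_card]
  refine ⟨fun x y h => ?_, ?_⟩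
  · have h0 : x.1 = y.1 := by rw [← permCons_zero x, h, permCons_zero]
    refine Prod.ext h0 (Equiv.ext fun j => ?_)
    have hj : x.1.succAbove (x.2 j) = y.1.succAbove (y.2 j) := by
      rw [← permCons_succ x, h, permCons_succ]
    rw [h0] at hj
    exact Fin.succAbove_right_injective hj
  · simp [Fintype.card_perm, Nat.factorial_succ]

/-- Expansion of a permanent along the first row. -/
lemma sum_perm_succ {k : ℕ} (c : Fin (k + 1) → Fin (k + 1) → ℝ) :
    ∑ σ : Equiv.Perm (Fin (k + 1)), ∏ j, c j (σ j) =
      ∑ i, c 0 i * ∑ τ : Equiv.Perm (Fin k), ∏ j : Fin k, c j.succ (i.succAbove (τ j)) := by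
  rw [← permCons_bijective.sum_comp, Fintype.sum_prod_type]
  refine Finset.sum_congr rfl (fun i _ => ?_)
  rw [Finset.mul_sum]
  refine Finset.sum_congr rfl (fun τ _ => ?_)
  rw [Fin.prod_univ_succ]
  rfl

lemma mid_eq_perm {k d : ℕ} (q : Fin k → Fin d → ℝ) :
    ((k.factorial : ℝ))⁻¹ * ∑ r : Fin k → Fin d,
        (∑ σ : Equiv.Perm (Fin k), ∏ j, q j (r (σ j))) ^ 2 =
      ∑ σ : Equiv.Perm (Fin k), ∏ j, ∑ s, q j s * q (σ j) s := by
  have hk : (k.factorial : ℝ) ≠ 0 := by positivity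
  rw [inv_mul_eq_iff_eq_mul₀ hk]
  have h1 : ∀ σ τ : Equiv.Perm (Fin k),
      ∑ r : Fin k → Fin d, (∏ j, q j (r (σ j))) * ∏ j, q j (r (τ j)) =
        ∏ j, ∑ s, q j s * q ((τ⁻¹ * σ) j) s := by
    intro σ τ
    have h2 : ∀ r : Fin k → Fin d, (∏ j, q j (r (σ j))) * ∏ j, q j (r (τ j)) =
        ∏ i, q (σ⁻¹ i) (r i) * q (τ⁻¹ i) (r i) := by
      intro r
      rw [Finset.prod_mul_distrib]
      congr 1
      · rw [← Equiv.prod_comp σ (fun i => q (σ⁻¹ i) (r i))]; simp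
      · rw [← Equiv.prod_comp τ (fun i => q (τ⁻¹ i) (r i))]; simp
    rw [Finset.sum_congr rfl (fun r _ => h2 r),
      ← Fintype.prod_sum (fun i s => q (σ⁻¹ i) s * q (τ⁻¹ i) s), ← Equiv.prod_comp σ]
    simp
  calc _ = ∑ σ : Equiv.Perm (Fin k), ∑ τ : Equiv.Perm (Fin k),
        ∑ r : Fin k → Fin d, (∏ j, q j (r (σ j))) * ∏ j, q j (r (τ j)) := by
        simp only [sq, Finset.sum_mul_sum]
        rw [Finset.sum_comm]
        exact Finset.sum_congr rfl (fun σ _ => Finset.sum_comm)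
    _ = ∑ σ : Equiv.Perm (Fin k), ∑ ρ : Equiv.Perm (Fin k), ∏ j, ∑ s, q j s * q (ρ j) s := by
        refine Finset.sum_congr rfl (fun σ _ => ?_)
        rw [Finset.sum_congr rfl (fun τ _ => h1 σ τ)]
        exact Fintype.sum_equiv ((Equiv.inv _).trans (Equiv.mulRight σ)) _ _ (fun τ => rfl)
    _ = _ := by
        rw [Finset.sum_const, Finset.card_univ, Fintype.card_perm, Fintype.card_fin, nsmul_eq_mul]

lemma perm_le {k d : ℕ} (q : Fin k → Fin d → ℝ) :
    ∑ σ : Equiv.Perm (Fin k), ∏ j, ∑ s, q j s * q (σ j) s ≤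
      (k.factorial : ℝ) * ∏ j, ∑ s, q j s ^ 2 := by
  have h : ∀ σ : Equiv.Perm (Fin k), ∏ j, ∑ s, q j s * q (σ j) s ≤ ∏ j, ∑ s, q j s ^ 2 := by
    intro σ
    calc _ ≤ |∏ j, ∑ s, q j s * q (σ j) s| := le_abs_self _
      _ = ∏ j, |∑ s, q j s * q (σ j) s| := Finset.abs_prod _ _
      _ ≤ ∏ j, (√(∑ s, q j s ^ 2) * √(∑ s, q (σ j) s ^ 2)) := by
          refine Finset.prod_le_prod (fun _ _ => abs_nonneg _) (fun j _ => ?_)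
          rw [← Real.sqrt_mul (Finset.sum_nonneg (fun _ _ => sq_nonneg _))]
          exact Real.abs_le_sqrt (Finset.sum_mul_sq_le_sq_mul_sq _ _ _)
      _ = ∏ j, ∑ s, q j s ^ 2 := by
          rw [Finset.prod_mul_distrib, Equiv.prod_comp σ (fun j => √(∑ s, q j s ^ 2)),
            ← Finset.prod_mul_distrib]
          exact Finset.prod_congr rfl
            (fun j _ => Real.mul_self_sqrt (Finset.sum_nonneg (fun _ _ => sq_nonneg _)))
  calc _ ≤ ∑ σ : Equiv.Perm (Fin k), ∏ j, ∑ s, q j s ^ 2 := Finset.sum_le_sum (fun σ _ => h σ)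
    _ = _ := by
      rw [Finset.sum_const, Finset.card_univ, Fintype.card_perm, Fintype.card_fin, nsmul_eq_mul]

end Comb
end PaperL1

namespace PaperL1
section Poisson

lemma tsum_pi {B : Type*} [NormedCommRing B] [NormOneClass B] [CompleteSpace B] :
    ∀ (d : ℕ) (f : Fin d → ℕ → B), (∀ r, Summable (fun m => ‖f r m‖)) →
      Summable (fun n : Fin d → ℕ => ‖∏ r, f r (n r)‖) ∧
        ∑' n : Fin d → ℕ, ∏ r, f r (n r) = ∏ r, ∑' m, f r m := by
  intro d
  induction d with
  | zero => intro f _; exact ⟨Summable.of_finite, by simp⟩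
  | succ d ih =>
    intro f hf
    obtain ⟨h1, h2⟩ := ih (fun r => f r.succ) (fun r => hf r.succ)
    have hs := (hf 0).mul_norm h1
    let e : ℕ × (Fin d → ℕ) ≃ (Fin (d + 1) → ℕ) := Fin.consEquiv (fun _ => ℕ)
    have he : ∀ x, ∏ r, f r (e x r) = f 0 x.1 * ∏ r : Fin d, f r.succ (x.2 r) := fun x => by
      rw [Fin.prod_univ_succ]; rfl
    constructor
    · rw [← e.summable_iff]
      refine hs.congr (fun x => ?_)
      simp only [Function.comp_apply, he]
    · rw [← e.tsum_eq, tsum_congr he, Fin.prod_univ_succ, ← h2]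
      exact (tsum_mul_tsum_of_summable_norm (hf 0) h1).symm

variable {d : ℕ}

/-- Product Poisson weights. -/
def wt (lam : Fin d → ℝ) (n : Fin d → ℕ) : ℝ :=
  ∏ r, (Real.exp (-lam r) * ((n r).factorial : ℝ)⁻¹ * lam r ^ n r)

/-- Unit multi-index. -/
def un (r : Fin d) : Fin d → ℕ := Pi.single r 1

/-- At most exponential growth. -/
def Grow (h : (Fin d → ℕ) → ℝ) : Prop :=
  ∃ C B : ℝ, 0 ≤ C ∧ 1 ≤ B ∧ ∀ n, |h n| ≤ C * B ^ (∑ r, n r)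

lemma Grow.add {h g : (Fin d → ℕ) → ℝ} (hh : Grow h) (hg : Grow g) :
    Grow (fun n => h n + g n) := by
  obtain ⟨C, B, hC, hB, H⟩ := hh
  obtain ⟨C', B', hC', hB', H'⟩ := hg
  refine ⟨C + C', B * B', by positivity, one_le_mul_of_one_le_of_one_le hB hB', fun n => ?_⟩
  have h1 : 1 ≤ B ^ (∑ r, n r) := one_le_pow₀ hB
  have h2 : 1 ≤ B' ^ (∑ r, n r) := one_le_pow₀ hB'
  rw [mul_pow]
  calc |h n + g n| ≤ |h n| + |g n| := abs_add_le _ _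
    _ ≤ C * B ^ (∑ r, n r) + C' * B' ^ (∑ r, n r) := add_le_add (H n) (H' n)
    _ ≤ C * (B ^ (∑ r, n r) * B' ^ (∑ r, n r)) + C' * (B ^ (∑ r, n r) * B' ^ (∑ r, n r)) := by
      refine add_le_add (mul_le_mul_of_nonneg_left ?_ hC) (mul_le_mul_of_nonneg_left ?_ hC')
      · exact le_mul_of_one_le_right (by linarith) h2
      · exact le_mul_of_one_le_left (by linarith) h1
    _ = _ := by ring

lemma Grow.mul {h g : (Fin d → ℕ) → ℝ} (hh : Grow h) (hg : Grow g) :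
    Grow (fun n => h n * g n) := by
  obtain ⟨C, B, hC, hB, H⟩ := hh
  obtain ⟨C', B', hC', hB', H'⟩ := hg
  refine ⟨C * C', B * B', by positivity, one_le_mul_of_one_le_of_one_le hB hB', fun n => ?_⟩
  rw [mul_pow, abs_mul]
  calc |h n| * |g n| ≤ (C * B ^ (∑ r, n r)) * (C' * B' ^ (∑ r, n r)) :=
        mul_le_mul (H n) (H' n) (abs_nonneg _) (by positivity)
    _ = _ := by ring

lemma Grow.const (c : ℝ) : Grow (fun _ : Fin d → ℕ => c) :=
  ⟨|c|, 1, abs_nonneg _, le_rfl, fun n => by simp⟩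

lemma Grow.abs {h : (Fin d → ℕ) → ℝ} (hh : Grow h) : Grow (fun n => |h n|) := by
  obtain ⟨C, B, hC, hB, H⟩ := hh
  exact ⟨C, B, hC, hB, fun n => by rw [abs_abs]; exact H n⟩

lemma Grow.sum {ι : Type*} (s : Finset ι) {h : ι → (Fin d → ℕ) → ℝ} (hh : ∀ i, Grow (h i)) :
    Grow (fun n => ∑ i ∈ s, h i n) := by
  induction s using Finset.induction_on with
  | empty => simpa using Grow.const 0
  | insert a s ha ih =>
    simp only [Finset.sum_insert ha]
    exact (hh a).add ih

lemma Grow.coord (r : Fin d) : Grow (fun n : Fin d → ℕ => (n r : ℝ)) := by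
  refine ⟨1, 2, by norm_num, by norm_num, fun n => ?_⟩
  rw [one_mul, Nat.abs_cast]
  have h1 : n r ≤ ∑ s, n s := Finset.single_le_sum (fun _ _ => Nat.zero_le _) (Finset.mem_univ r)
  have h2 : n r ≤ 2 ^ (∑ s, n s) := h1.trans (Nat.lt_two_pow_self).le
  exact_mod_cast h2

lemma Grow.down {h : (Fin d → ℕ) → ℝ} (hh : Grow h) (r : Fin d) :
    Grow (fun n => h (n - un r)) := by
  obtain ⟨C, B, hC, hB, H⟩ := hh
  refine ⟨C, B, hC, hB, fun n => (H _).trans (mul_le_mul_of_nonneg_left ?_ hC)⟩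
  exact pow_le_pow_right₀ hB (Finset.sum_le_sum (fun s _ => Nat.sub_le _ _))

lemma Grow.up {h : (Fin d → ℕ) → ℝ} (hh : Grow h) (r : Fin d) :
    Grow (fun n => h (n + un r)) := by
  obtain ⟨C, B, hC, hB, H⟩ := hh
  refine ⟨C * B, B, by positivity, hB, fun n => (H _).trans (le_of_eq ?_)⟩
  have : ∑ s, (n + un r) s = ∑ s, n s + 1 := by
    simp [un, Finset.sum_add_distrib]
  rw [this]; ring

variable (lam : Fin d → ℝ) 

lemma wt_nonneg (hlam : ∀ r, 0 < lam r) (n : Fin d → ℕ) : 0 ≤ wt lam n :=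
  Finset.prod_nonneg (fun r _ => by have := hlam r; positivity)

lemma wt_up (hlam : ∀ r, 0 < lam r) (r : Fin d) (n : Fin d → ℕ) :
    wt lam (n + un r) * (((n + un r) r : ℕ) / lam r) = wt lam n := by
  unfold wt
  rw [← Finset.mul_prod_erase _ _ (Finset.mem_univ r),
    ← Finset.mul_prod_erase _ (fun r => Real.exp (-lam r) * ((n r).factorial : ℝ)⁻¹ * lam r ^ n r)
      (Finset.mem_univ r)]
  have h1 : ∀ s ∈ Finset.univ.erase r, Real.exp (-lam s) *
      (((n + un r) s).factorial : ℝ)⁻¹ * lam s ^ (n + un r) s =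
      Real.exp (-lam s) * ((n s).factorial : ℝ)⁻¹ * lam s ^ n s := by
    intro s hs
    have : (n + un r) s = n s := by simp [un, Finset.ne_of_mem_erase hs]
    rw [this]
  rw [Finset.prod_congr rfl h1]
  have h2 : (n + un r) r = n r + 1 := by simp [un]
  rw [h2, Nat.factorial_succ, pow_succ]
  have h3 := (hlam r).ne'
  have h4 : ((n r).factorial : ℝ) ≠ 0 := by positivity
  have h5 : ((n r : ℝ) + 1) ≠ 0 := by positivity
  push_cast
  field_simp

lemma hasSum_exp_real (x : ℝ) : HasSum (fun n : ℕ => (n.factorial : ℝ)⁻¹ * x ^ n) (Real.exp x) := by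
  have := NormedSpace.exp_series_hasSum_exp' (𝕂 := ℝ) x
  rwa [← Real.exp_eq_exp_ℝ] at this

lemma summable_wt_pow (hlam : ∀ r, 0 < lam r) (B : ℝ) (hB : 0 ≤ B) :
    Summable (fun n => wt lam n * B ^ (∑ r, n r)) := by
  have := (tsum_pi d (fun r m => Real.exp (-lam r) * ((m.factorial : ℝ)⁻¹ * (lam r * B) ^ m))
    (fun r => ((hasSum_exp_real (lam r * B)).summable.mul_left _).norm)).1.of_norm
  refine this.congr (fun n => ?_)
  rw [wt, ← Finset.prod_pow_eq_pow_sum, ← Finset.prod_mul_distrib]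
  exact Finset.prod_congr rfl (fun r _ => by rw [mul_pow]; ring)

lemma tsum_wt : ∑' n, wt lam n = 1 := by
  have := (tsum_pi d (fun r m => Real.exp (-lam r) * ((m.factorial : ℝ)⁻¹ * (lam r) ^ m))
    (fun r => ((hasSum_exp_real (lam r)).summable.mul_left _).norm)).2
  simp only [tsum_mul_left, (hasSum_exp_real _).tsum_eq, ← Real.exp_add] at this
  simpa [wt, mul_assoc] using this

lemma Grow.summable (hlam : ∀ r, 0 < lam r) {h : (Fin d → ℕ) → ℝ} (hh : Grow h) :
    Summable (fun n => wt lam n * h n) := by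
  obtain ⟨C, B, hC, hB, H⟩ := hh
  refine Summable.of_norm_bounded ((summable_wt_pow lam hlam B (by linarith)).mul_left C) (fun n => ?_)
  have h0 := wt_nonneg lam hlam n
  rw [Real.norm_eq_abs, abs_mul, abs_of_nonneg h0]
  calc _ ≤ wt lam n * (C * B ^ (∑ r, n r)) := mul_le_mul_of_nonneg_left (H n) h0
    _ = _ := by ring

/-- Raising operator. -/
def Tp (p : Fin d → ℝ) : ((Fin d → ℕ) → ℝ) →ₗ[ℝ] ((Fin d → ℕ) → ℝ) where
  toFun h := fun n => ∑ r, p r * (n r / lam r * h (n - un r) - h n)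
  map_add' h g := by
    funext n
    simp only [Pi.add_apply, ← Finset.sum_add_distrib]
    exact Finset.sum_congr rfl (fun r _ => by ring)
  map_smul' c h := by
    funext n
    simp only [Pi.smul_apply, smul_eq_mul, RingHom.id_apply, Finset.mul_sum]
    exact Finset.sum_congr rfl (fun r _ => by ring)

lemma Tp_apply (p : Fin d → ℝ) (h : (Fin d → ℕ) → ℝ) (n : Fin d → ℕ) :
    Tp lam p h n = ∑ r, p r * (n r / lam r * h (n - un r) - h n) := rfl

lemma Grow.Tp (p : Fin d → ℝ) {h : (Fin d → ℕ) → ℝ} (hh : Grow h) : Grow (Tp lam p h) := by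
  change Grow (fun n => ∑ r, p r * (n r / lam r * h (n - un r) - h n))
  refine Grow.sum _ (fun r => (Grow.const (p r)).mul ?_)
  have h1 := ((Grow.coord r).mul (Grow.const (lam r)⁻¹)).mul (hh.down r)
  have h2 := h1.add ((Grow.const (-1)).mul hh)
  convert h2 using 2
  ring

/-- Lowering operator. -/
def Dq (q : Fin d → ℝ) (h : (Fin d → ℕ) → ℝ) : (Fin d → ℕ) → ℝ :=
  fun n => ∑ r, q r * (h (n + un r) - h n)

lemma key_shift (h : (Fin d → ℕ) → ℝ) (n : Fin d → ℕ) (r s : Fin d) :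
    (((n + un r) s : ℕ) : ℝ) / lam s * h (n + un r - un s) =
      n s / lam s * h (n - un s + un r) + if r = s then (lam s)⁻¹ * h n else 0 := by
  split_ifs with hrs
  · subst hrs
    have h1 : n + un r - un r = n := by simp
    have h2 : (n + un r) r = n r + 1 := by simp [un]
    rw [h1, h2]
    by_cases h0 : n r = 0
    · simp [h0]
    · have h3 : n - un r + un r = n := by
        funext t
        by_cases ht : t = r
        · subst ht; simp [un]; omega
        · simp [un, ht]
      rw [h3]; push_cast; ring
  · have h2 : (n + un r) s = n s := by simp [un, Ne.symm hrs]
    have h3 : n + un r - un s = n - un s + un r := by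
      funext t
      by_cases ht : t = s
      · subst ht; simp [un, Ne.symm hrs]
      · simp [un, ht]
    rw [h2, h3, add_zero]

lemma Dq_Tp (q p : Fin d → ℝ) (h : (Fin d → ℕ) → ℝ) :
    Dq q (Tp lam p h) = Tp lam p (Dq q h) + (∑ r, q r * p r / lam r) • h := by
  funext n
  have h1 : Dq q (Tp lam p h) n = ∑ r, ∑ s, q r * (p s * ((((n + un r) s : ℕ) : ℝ) / lam s *
      h (n + un r - un s) - h (n + un r)) - p s * (n s / lam s * h (n - un s) - h n)) := by
    simp only [Dq, Tp_apply]
    refine Finset.sum_congr rfl (fun r _ => ?_)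
    rw [← Finset.sum_sub_distrib, Finset.mul_sum]
  have h2 : Tp lam p (Dq q h) n = ∑ r, ∑ s, p s * (n s / lam s * (q r * (h (n - un s + un r) -
      h (n - un s))) - q r * (h (n + un r) - h n)) := by
    rw [Finset.sum_comm]
    simp only [Dq, Tp_apply]
    refine Finset.sum_congr rfl (fun s _ => ?_)
    rw [← Finset.mul_sum, Finset.sum_sub_distrib, ← Finset.mul_sum]
  have h3 : (∑ r, q r * p r / lam r) * h n =
      ∑ r, ∑ s, q r * (p s * if r = s then (lam s)⁻¹ * h n else 0) := by
    rw [Finset.sum_mul]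
    refine Finset.sum_congr rfl (fun r _ => ?_)
    rw [Finset.sum_eq_single r]
    · rw [if_pos rfl]; ring
    · intro s _ hs; rw [if_neg (Ne.symm hs)]; ring
    · simp
  rw [Pi.add_apply, Pi.smul_apply, smul_eq_mul, h1, h2, h3]
  simp only [← Finset.sum_add_distrib]
  refine Finset.sum_congr rfl (fun r _ => Finset.sum_congr rfl (fun s _ => ?_))
  rw [key_shift]
  ring

/-- Iterated raising operators applied to the constant one. -/
def ch : (k : ℕ) → (Fin k → Fin d → ℝ) → (Fin d → ℕ) → ℝ
  | 0, _ => fun _ => 1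
  | k + 1, f => Tp lam (f 0) (ch k (fun j => f j.succ))

lemma grow_ch : ∀ (k : ℕ) (f : Fin k → Fin d → ℝ), Grow (ch lam k f)
  | 0, _ => Grow.const 1
  | k + 1, f => (grow_ch k (fun j => f j.succ)).Tp lam (f 0)

lemma Dq_ch (q : Fin d → ℝ) : ∀ (k : ℕ) (f : Fin (k + 1) → Fin d → ℝ),
    Dq q (ch lam (k + 1) f) =
      ∑ i, (∑ r, q r * f i r / lam r) • ch lam k (fun j => f (i.succAbove j)) := by
  intro k
  induction k with
  | zero =>
    intro f
    have h0 : Dq q (ch lam 0 (fun j => f j.succ)) = 0 := by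
      funext n; simp [Dq, ch]
    rw [ch, Dq_Tp, h0, map_zero, zero_add]
    simp [ch]
  | succ k ih =>
    intro f
    rw [ch, Dq_Tp, ih, map_sum (Tp lam (f 0)), add_comm]
    refine Eq.trans ?_ (Fin.sum_univ_succ _).symm
    congr 1
    refine Finset.sum_congr rfl (fun i _ => ?_)
    rw [map_smul]
    congr 1
    rw [ch]
    simp

section S
variable {B : Type*} [NormedAddCommGroup B] [NormedSpace ℝ B] [CompleteSpace B]

lemma summable_S (hlam : ∀ r, 0 < lam r) {h : (Fin d → ℕ) → ℝ} (hh : Grow h)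
    {g : (Fin d → ℕ) → B} (hg : Grow (fun n => ‖g n‖)) :
    Summable (fun n => (wt lam n * h n) • g n) := by
  refine Summable.of_norm ?_
  refine ((hh.abs.mul hg).summable lam hlam).congr (fun n => ?_)
  rw [norm_smul, norm_mul, Real.norm_eq_abs, Real.norm_eq_abs, abs_of_nonneg (wt_nonneg lam hlam n),
    mul_assoc]

lemma hasSum_raise (hlam : ∀ r, 0 < lam r) {h : (Fin d → ℕ) → ℝ} (hh : Grow h)
    {g : (Fin d → ℕ) → B} (hg : Grow (fun n => ‖g n‖)) (r : Fin d) :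
    HasSum (fun n => (wt lam n * (n r / lam r * h (n - un r))) • g n)
      (∑' n, (wt lam n * h n) • g (n + un r)) := by
  have hinj : Function.Injective (fun n : Fin d → ℕ => n + un r) := add_left_injective _
  rw [← hinj.hasSum_iff]
  · have h1 := (summable_S lam hlam hh (hg.up r)).hasSum
    convert h1 using 2 with n
    simp only [Function.comp_apply]
    rw [← mul_assoc, wt_up lam hlam, add_tsub_cancel_right]
  · intro n hn
    have : n r = 0 := by
      by_contra h0
      refine hn ⟨n - un r, ?_⟩
      funext t
      by_cases ht : t = r
      · subst ht; simp [un]; omega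
      · simp [un, ht]
    simp [this]

lemma S_Tp (hlam : ∀ r, 0 < lam r) {h : (Fin d → ℕ) → ℝ} (hh : Grow h)
    {g : (Fin d → ℕ) → B} (hg : Grow (fun n => ‖g n‖)) (p : Fin d → ℝ) :
    ∑' n, (wt lam n * Tp lam p h n) • g n =
      ∑ r, p r • (∑' n, (wt lam n * h n) • g (n + un r) - ∑' n, (wt lam n * h n) • g n) := by
  have h1 := hasSum_sum (s := Finset.univ) (fun r _ => ((hasSum_raise lam hlam hh hg r).sub
    (summable_S lam hlam hh hg).hasSum).const_smul (p r))
  rw [← h1.tsum_eq]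
  refine tsum_congr (fun n => ?_)
  simp only [← sub_smul, smul_smul, ← Finset.sum_smul, Tp_apply, Finset.mul_sum]
  congr 1
  exact Finset.sum_congr rfl (fun r _ => by ring)
end S

lemma pair_ch (hlam : ∀ r, 0 < lam r) : ∀ (k : ℕ) (f g : Fin k → Fin d → ℝ),
    ∑' n, (wt lam n * ch lam k f n) * ch lam k g n =
      ∑ σ : Equiv.Perm (Fin k), ∏ j, ∑ r, f j r * g (σ j) r / lam r := by
  intro k
  induction k with
  | zero => intro f g; simp [ch, tsum_wt]
  | succ k ih =>
    intro f g
    have hG : ∀ (k : ℕ) (g : Fin k → Fin d → ℝ), Grow (fun n => ‖ch lam k g n‖) :=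
      fun k g => (grow_ch lam k g).abs
    have hF := grow_ch lam k (fun j => f j.succ)
    have h1 := S_Tp lam hlam hF (hG (k + 1) g) (f 0)
    simp only [smul_eq_mul] at h1
    rw [ch, h1, sum_perm_succ (fun j i => ∑ r, f j r * g i r / lam r)]
    have hs1 : ∀ r, Summable (fun n => wt lam n * ch lam k (fun j => f j.succ) n *
        ch lam (k + 1) g (n + un r)) := fun r => summable_S lam hlam hF ((hG (k + 1) g).up r)
    have hs2 : Summable (fun n => wt lam n * ch lam k (fun j => f j.succ) n *
        ch lam (k + 1) g n) := summable_S lam hlam hF (hG (k + 1) g)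
    have h2 : ∑ r, f 0 r * (∑' n, wt lam n * ch lam k (fun j => f j.succ) n *
          ch lam (k + 1) g (n + un r) - ∑' n, wt lam n * ch lam k (fun j => f j.succ) n *
          ch lam (k + 1) g n) =
        ∑' n, wt lam n * ch lam k (fun j => f j.succ) n * Dq (f 0) (ch lam (k + 1) g) n := by
      have := hasSum_sum (s := Finset.univ) (fun r _ => (((hs1 r).hasSum.sub hs2.hasSum).mul_left (f 0 r)))
      rw [← this.tsum_eq]
      refine tsum_congr (fun n => ?_)
      rw [Dq, Finset.mul_sum]
      exact Finset.sum_congr rfl (fun r _ => by ring)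
    rw [h2, Dq_ch]
    have h3 := hasSum_sum (s := Finset.univ) (fun (i : Fin (k + 1)) _ =>
      ((summable_S lam hlam hF (hG k (fun j => g (i.succAbove j)))).hasSum.mul_left
        (∑ r, f 0 r * g i r / lam r)))
    simp only [smul_eq_mul] at h3
    calc _ = _ := tsum_congr (fun n => ?_)
      _ = _ := h3.tsum_eq
      _ = _ := Finset.sum_congr rfl (fun i _ => by rw [ih])
    rw [Finset.sum_apply, Finset.mul_sum]
    exact Finset.sum_congr rfl (fun i _ => by rw [Pi.smul_apply, smul_eq_mul]; ring)

lemma jensen (hlam : ∀ r, 0 < lam r) {h : (Fin d → ℕ) → ℝ} (hh : Grow h) :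
    ∑' n, wt lam n * |h n| ≤ √(∑' n, wt lam n * h n * h n) := by
  set m := ∑' n, wt lam n * |h n| with hm
  have s1 := (hh.abs.summable lam hlam).hasSum
  have s2 := ((hh.mul hh).summable lam hlam).hasSum
  have s3 : HasSum (wt lam) 1 := by
    have := ((Grow.const 1).summable lam hlam).hasSum
    simpa [tsum_wt] using this
  have h1 := (s2.sub (s1.mul_left (2 * m))).add (s3.mul_left (m ^ 2))
  have h2 := h1.nonneg (fun n => by
    have : 0 ≤ wt lam n * (|h n| - m) ^ 2 := mul_nonneg (wt_nonneg lam hlam n) (sq_nonneg _)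
    have e : (|h n| - m) ^ 2 = h n * h n - 2 * m * |h n| + m ^ 2 := by
      rw [sub_sq, sq_abs]; ring
    rw [e] at this
    linarith)
  refine Real.le_sqrt_of_sq_le ?_
  simp only [mul_assoc]
  rw [← hm] at h2
  linarith

section Main
variable {B : Type*} [NormedCommRing B] [NormedAlgebra ℝ B] [NormOneClass B] [CompleteSpace B]

lemma Phi_one (u : Fin d → B) :
    ∑' n : Fin d → ℕ, (wt lam n * 1) • ∏ r, u r ^ n r =
      NormedSpace.exp (∑ r, lam r • (u r - 1)) := by
  have hE : ∀ r, HasSum (fun m : ℕ => (m.factorial : ℝ)⁻¹ • (lam r • u r) ^ m)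
    (NormedSpace.exp (lam r • u r)) := fun r => NormedSpace.exp_series_hasSum_exp' (𝕂 := ℝ) _
  have hN : ∀ r, Summable (fun m : ℕ => ‖(m.factorial : ℝ)⁻¹ • (lam r • u r) ^ m‖) :=
    fun r => NormedSpace.norm_expSeries_summable' (𝕂 := ℝ) _
  have h := (tsum_pi d (fun r m => Real.exp (-lam r) • ((m.factorial : ℝ)⁻¹ • (lam r • u r) ^ m))
    (fun r => by simpa only [norm_smul _ (_ • _)] using (hN r).mul_left _)).2
  let _ : NormedAlgebra ℚ B := NormedAlgebra.restrictScalars ℚ ℝ B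
  rw [NormedSpace.exp_sum]
  calc _ = _ := tsum_congr (fun n => ?_)
    _ = _ := h
    _ = _ := Finset.prod_congr rfl (fun r _ => ?_)
  · simp only [Algebra.smul_def, map_prod, wt, mul_one, ← Finset.prod_mul_distrib, map_mul, mul_pow, map_pow,
      mul_assoc]
  · rw [((hE r).const_smul (Real.exp (-lam r))).tsum_eq, smul_sub, sub_eq_add_neg,
      NormedSpace.exp_add, ← neg_smul, ← Algebra.algebraMap_eq_smul_one,
      ← NormedSpace.algebraMap_exp_comm, ← Real.exp_eq_exp_ℝ, mul_comm, Algebra.smul_def]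

lemma grow_u (u : Fin d → B) (hu : ∀ r, ‖u r‖ ≤ 1) :
    Grow (fun n : Fin d → ℕ => ‖∏ r, u r ^ n r‖) := by
  refine ⟨1, 1, zero_le_one, le_rfl, fun n => ?_⟩
  rw [abs_norm, one_pow, one_mul]
  refine (Finset.norm_prod_le _ _).trans (Finset.prod_le_one (fun _ _ => norm_nonneg _) (fun r _ => ?_))
  exact (norm_pow_le _ _).trans (pow_le_one₀ (norm_nonneg _) (hu r))

lemma Phi_ch (hlam : ∀ r, 0 < lam r) (u : Fin d → B) (hu : ∀ r, ‖u r‖ ≤ 1) :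
    ∀ (k : ℕ) (f : Fin k → Fin d → ℝ),
    ∑' n : Fin d → ℕ, (wt lam n * ch lam k f n) • ∏ r, u r ^ n r =
      (∏ j, ∑ r, f j r • (u r - 1)) * NormedSpace.exp (∑ r, lam r • (u r - 1)) := by
  intro k
  induction k with
  | zero => intro f; simpa [ch] using Phi_one lam u
  | succ k ih =>
    intro f
    have hs := summable_S lam hlam (grow_ch lam k (fun j => f j.succ)) (grow_u u hu)
    rw [ch, S_Tp lam hlam (grow_ch lam k _) (grow_u u hu) (f 0), Fin.prod_univ_succ, mul_assoc,
      ← ih (fun j => f j.succ), Finset.sum_mul]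
    refine Finset.sum_congr rfl (fun r _ => ?_)
    rw [smul_mul_assoc, sub_mul, one_mul, ← hs.tsum_mul_left]
    congr 2
    refine tsum_congr (fun n => ?_)
    rw [mul_smul_comm]
    congr 1
    simp only [Pi.add_apply, pow_add, Finset.prod_mul_distrib]
    rw [mul_comm]
    congr 1
    rw [Finset.prod_eq_single r] <;> simp +contextual [un]

lemma banach_estimate (hlam : ∀ r, 0 < lam r) (u : Fin d → B) (hu : ∀ r, ‖u r‖ ≤ 1)
    (k : ℕ) (f : Fin k → Fin d → ℝ) :
    ‖(∏ j, ∑ r, f j r • (u r - 1)) * NormedSpace.exp (∑ r, lam r • (u r - 1))‖ ≤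
      √(∑ σ : Equiv.Perm (Fin k), ∏ j, ∑ r, f j r * f (σ j) r / lam r) := by
  have hg := grow_ch lam k f
  rw [← Phi_ch lam hlam u hu, ← pair_ch lam hlam]
  refine le_trans ?_ (jensen lam hlam hg)
  refine tsum_of_norm_bounded (hg.abs.summable lam hlam).hasSum (fun n => ?_)
  have h1 : ‖∏ r, u r ^ n r‖ ≤ 1 :=
    (Finset.norm_prod_le _ _).trans (Finset.prod_le_one (fun _ _ => norm_nonneg _)
      (fun r _ => (norm_pow_le _ _).trans (pow_le_one₀ (norm_nonneg _) (hu r))))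
  rw [norm_smul, norm_mul, Real.norm_eq_abs, Real.norm_eq_abs, abs_of_nonneg (wt_nonneg lam hlam n)]
  exact mul_le_of_le_one_right (mul_nonneg (wt_nonneg lam hlam n) (abs_nonneg _)) h1

end Main
end Poisson
end PaperL1

/-- Lemma 4.1 of Roos: the smoothness estimate
`‖(Π_j R_j) G‖ ≤ ((1/k!) Σ_{r∈{1,…,d}^k} (Σ_{σ∈S_k} Π_j p_{j,r_{σ(j)}}/√λ_{r_{σ(j)}})²)^{1/2}
≤ √(k!) Π_j (Σ_r p_{j,r}²/λ_r)^{1/2}`. -/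
theorem smoothness_estimate_charlier
    {X : Type*} [AddCommMonoid X] [Countable X]
    (d k : ℕ) (hd : 1 ≤ d) (hk : 1 ≤ k)
    (p : Fin k → Fin d → ℝ) (lam : Fin d → ℝ) (hlam : ∀ r, 0 < lam r)
    (U : Fin d → X → ℝ) (hU : ∀ r, IsPmf (U r))
    (W : Fin d → X → ℝ) (hW : ∀ r, W r = U r - delta 0)
    (R : Fin k → X → ℝ) (hR : ∀ j, R j = ∑ r, p j r • W r)
    (G : X → ℝ) (hG : G = convExp (∑ r, lam r • W r))
    (mid : ℝ)
    (hmid : mid = Real.sqrt (((k.factorial : ℝ))⁻¹ *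
      ∑ r : Fin k → Fin d,
        (∑ σ : Equiv.Perm (Fin k),
          ∏ j, p j (r (σ j)) / Real.sqrt (lam (r (σ j)))) ^ 2)) :
    l1norm (conv (convProd Finset.univ R) G) ≤ mid ∧
      mid ≤ Real.sqrt (k.factorial : ℝ) *
        ∏ j, Real.sqrt (∑ r, (p j r) ^ 2 / lam r) := by
  have hq : ∀ i j : Fin k, ∑ r, p i r / √(lam r) * (p j r / √(lam r)) =
      ∑ r, p i r * p j r / lam r := fun i j => Finset.sum_congr rfl (fun r _ => by
    rw [div_mul_div_comm, Real.mul_self_sqrt (hlam r).le])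
  have hmid2 : mid = √(∑ σ : Equiv.Perm (Fin k), ∏ j, ∑ r, p j r * p (σ j) r / lam r) := by
    rw [hmid, mid_eq_perm (fun j r => p j r / √(lam r))]
    simp only [hq]
  constructor
  · let u : Fin d → L1 X := fun r => L1.mk (U r) (hU r).2.summable
    have hu : ∀ r, ‖u r‖ ≤ 1 := fun r => (L1.norm_of_pmf (hU r)).le
    have hWu : ∀ r, W r = (u r - 1).fn := fun r => hW r
    have hRu : R = fun j => (∑ r, p j r • (u r - 1)).fn := by
      funext j
      rw [hR, L1.fn_sum]
      simp only [L1.fn_smul, hWu]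
    have hGu : G = (NormedSpace.exp (∑ r, lam r • (u r - 1))).fn := by
      rw [hG, L1.fn_exp, L1.fn_sum]
      simp only [L1.fn_smul, hWu]
    rw [hRu, hGu, ← L1.fn_prod, ← L1.fn_mul, l1norm, ← L1.norm_eq, hmid2]
    exact banach_estimate lam hlam u hu k p
  · have h1 := perm_le (fun j r => p j r / √(lam r))
    have h2 : ∀ j, ∑ r, (p j r / √(lam r)) ^ 2 = ∑ r, p j r ^ 2 / lam r := fun j =>
      Finset.sum_congr rfl (fun r _ => by rw [div_pow, Real.sq_sqrt (hlam r).le])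
    simp only [hq, h2] at h1
    rw [hmid2, ← Real.sqrt_prod Finset.univ (fun j _ => Finset.sum_nonneg
      (fun r _ => div_nonneg (sq_nonneg _) (hlam r).le)), ← Real.sqrt_mul (by positivity)]
    exact Real.sqrt_le_sqrt h1
end
end

section
/- Let X be a countable commutative additive monoid, d ≥ 1 an integer, p_{1,r}, p_{2,r} ∈ ℝ and λ_r ∈ (0,∞) for r ∈ {1,…,d}, U_r probability mass functions in ℓ¹(X), W_r = U_r − δ₀, R_j = Σ_{r=1}^d p_{j,r} W_r for j ∈ {1,2}, and G = exp(Σ_{r=1}^d λ_r W_r). Then: (i) ‖R_1 * G‖ ≤ ( Σ_{r=1}^d p_{1,r}²/λ_r )^{1/2}; and (ii) ‖R_1 * R_2 * G‖ ≤ ( (1/2) Σ_{r=1}^d Σ_{s=1}^d (p_{1,r}p_{2,s} + p_{1,s}p_{2,r})² / (λ_r λ_s) )^{1/2} ≤ √2 · ( Σ_{r=1}^d p_{1,r}²/λ_r )^{1/2} · ( Σ_{r=1}^d p_{2,r}²/λ_r )^{1/2}. -/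
open scoped Classical BigOperators

noncomputable section

open PaperL1

namespace PaperL1

section Markov

variable {Y V : Type*} [NormedAddCommGroup V] [NormedSpace ℝ V]

/-- Positive operators (with respect to a family of evaluations). -/
def PosOp (ev : Y → V →L[ℝ] ℝ) (B : V →L[ℝ] V) : Prop :=
  ∀ f : V, (∀ x, 0 ≤ ev x f) → ∀ x, 0 ≤ ev x (B f)

/-- `M` is a pointwise multiplication and `o` the constant function one. -/
structure IsMul (ev : Y → V →L[ℝ] ℝ) (M : V →L[ℝ] V →L[ℝ] V) (o : V) : Prop where
  mul : ∀ x f g, ev x (M f g) = ev x f * ev x g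
  one : ∀ x, ev x o = 1

variable {ev : Y → V →L[ℝ] ℝ} {M : V →L[ℝ] V →L[ℝ] V} {o : V}

theorem PosOp.mono {B : V →L[ℝ] V} (hB : PosOp ev B) {f g : V}
    (h : ∀ x, ev x f ≤ ev x g) (x : Y) : ev x (B f) ≤ ev x (B g) := by
  have := hB (g - f) (fun x => by simpa using h x) x
  simpa using this

theorem PosOp.jensen (hM : IsMul ev M o) {B : V →L[ℝ] V} (hB : PosOp ev B) (h1 : B o = o)
    (g : V) (x : Y) : (ev x (B g)) ^ 2 ≤ ev x (B (M g g)) := by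
  have h := hB (M g g - (2 * ev x (B g)) • g + ((ev x (B g)) ^ 2) • o) (fun y => by
    simp only [map_add, map_sub, map_smul, hM.mul, hM.one, smul_eq_mul]
    nlinarith [sq_nonneg (ev y g - ev x (B g))]) x
  simp only [map_add, map_sub, map_smul, h1, hM.one, smul_eq_mul] at h
  nlinarith

theorem PosOp.exp [CompleteSpace V] {S : V →L[ℝ] V} (hS : PosOp ev S) :
    PosOp ev (NormedSpace.exp S) := by
  intro f hf x
  have hpow : ∀ n : ℕ, ∀ x, 0 ≤ ev x ((S ^ n) f) := by
    intro n
    induction n with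
    | zero => simpa using hf
    | succ n ih =>
      intro x
      rw [pow_succ']
      exact hS _ ih x
  have h := NormedSpace.exp_series_hasSum_exp' (𝕂 := ℝ) S
  have h2 := h.mapL ((ev x).comp (ContinuousLinearMap.apply ℝ _ f))
  refine h2.nonneg ?_
  intro n
  have e : ((ev x).comp (ContinuousLinearMap.apply ℝ _ f))
      (((n.factorial : ℝ)⁻¹) • S ^ n) = (n.factorial : ℝ)⁻¹ * ev x ((S ^ n) f) := by
    simp
  rw [e]
  have := hpow n x
  positivity

variable {d : ℕ} (lam : Fin d → ℝ) (B : Fin d → V →L[ℝ] V)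

/-- The generator. -/
def gen : V →L[ℝ] V := ∑ r, lam r • (B r - 1)

theorem gen_apply (f : V) : gen lam B f = ∑ r, lam r • (B r f - f) := by
  simp [gen]

/-- The semigroup. -/
def sg (s : ℝ) : V →L[ℝ] V := NormedSpace.exp (s • gen lam B)

theorem sg_pos [CompleteSpace V] (hlam : ∀ r, 0 < lam r) (hB : ∀ r, PosOp ev (B r))
    {s : ℝ} (hs : 0 ≤ s) : PosOp ev (sg lam B s) := by
  let : NormedAlgebra ℚ (V →L[ℝ] V) := NormedAlgebra.restrictScalars ℚ ℝ _
  have e : s • gen lam B = algebraMap ℝ (V →L[ℝ] V) (-(s * ∑ r, lam r))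
      + s • ∑ r, lam r • B r := by
    rw [gen, Algebra.algebraMap_eq_smul_one]
    simp only [smul_sub, Finset.sum_sub_distrib, ← Finset.sum_smul, neg_smul, mul_smul]
    abel
  have hS : PosOp ev (s • ∑ r, lam r • B r) := by
    intro f hf x
    have : ev x ((s • ∑ r, lam r • B r) f) = s * ∑ r, lam r * ev x (B r f) := by
      simp
    rw [this]
    exact mul_nonneg hs (Finset.sum_nonneg fun r _ => mul_nonneg (hlam r).le (hB r f hf x))
  intro f hf x
  have e2 : sg lam B s f = Real.exp (-(s * ∑ r, lam r)) •
      (NormedSpace.exp (s • ∑ r, lam r • B r)) f := by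
    rw [sg, e, NormedSpace.exp_add_of_commute (Algebra.commutes _ _),
      ← NormedSpace.algebraMap_exp_comm, ← Real.exp_eq_exp_ℝ, Algebra.algebraMap_eq_smul_one]
    simp
  have := hS.exp f hf x
  rw [e2, map_smul, smul_eq_mul]
  positivity

theorem sg_zero : sg lam B 0 = 1 := by
  rw [sg, zero_smul, NormedSpace.exp_zero]

theorem sg_add [CompleteSpace V] (s t : ℝ) : sg lam B (s + t) = sg lam B s * sg lam B t := by
  let : NormedAlgebra ℚ (V →L[ℝ] V) := NormedAlgebra.restrictScalars ℚ ℝ _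
  rw [sg, add_smul, NormedSpace.exp_add_of_commute]
  · rfl
  · exact ((Commute.refl _).smul_left _).smul_right _

theorem gen_one (h1 : ∀ r, B r o = o) : gen lam B o = 0 := by
  simp [gen, h1]

theorem sg_one [CompleteSpace V] (h1 : ∀ r, B r o = o) (s : ℝ) : sg lam B s o = o := by
  have h := NormedSpace.exp_series_hasSum_exp' (𝕂 := ℝ) (s • gen lam B)
  have h2 := h.mapL (ContinuousLinearMap.apply ℝ _ o)
  refine h2.unique ?_
  convert hasSum_single (0 : ℕ) ?_ using 1
  · simp
  · intro n hn
    obtain ⟨m, rfl⟩ := Nat.exists_eq_succ_of_ne_zero hn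
    rw [ContinuousLinearMap.apply_apply, pow_succ]
    change ((m.succ.factorial : ℝ)⁻¹) • (((s • gen lam B) ^ m) (s • (gen lam B o))) = 0
    rw [gen_one lam B h1, smul_zero, map_zero, smul_zero]

theorem sg_comm (hc : ∀ r s, Commute (B r) (B s)) (r : Fin d) (s : ℝ) :
    Commute (B r - 1) (sg lam B s) := by
  refine Commute.exp_right (Commute.smul_right ?_ _)
  refine Commute.sum_right _ _ _ fun q _ => Commute.smul_right ?_ _
  exact ((hc r q).sub_right (Commute.one_right _)).sub_left (Commute.one_left _)

theorem gamma_ge (hM : IsMul ev M o) (hlam : ∀ r, 0 < lam r) (hB : ∀ r, PosOp ev (B r))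
    (h1 : ∀ r, B r o = o) (g : V) (x : Y) :
    ev x (∑ r, lam r • (M ((B r - 1) g) ((B r - 1) g)))
      ≤ ev x (gen lam B (M g g) - (M (gen lam B g) g + M g (gen lam B g))) := by
  have e1 : ev x (∑ r, lam r • (M ((B r - 1) g) ((B r - 1) g)))
      = ∑ r, lam r * (ev x (B r g) - ev x g) ^ 2 := by
    simp only [map_sum, map_smul, hM.mul, smul_eq_mul]
    simp [pow_two]
  have e2 : ev x (gen lam B (M g g) - (M (gen lam B g) g + M g (gen lam B g)))
      = ∑ r, lam r * (ev x (B r (M g g)) - 2 * ev x g * ev x (B r g) + ev x g ^ 2) := by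
    simp only [map_sub, map_add, hM.mul]
    simp only [gen_apply, map_sub, map_smul, hM.mul, map_sum, smul_eq_mul, Finset.mul_sum,
      Finset.sum_mul]
    rw [← Finset.sum_add_distrib, ← Finset.sum_sub_distrib]
    refine Finset.sum_congr rfl fun r _ => ?_
    ring
  rw [e1, e2]
  refine Finset.sum_le_sum fun r _ => mul_le_mul_of_nonneg_left ?_ (hlam r).le
  nlinarith [(hB r).jensen hM (h1 r) g x]

variable [CompleteSpace V]

theorem sg_deriv (M : V →L[ℝ] V →L[ℝ] V) (t s : ℝ) (f : V) (x : Y) :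
    HasDerivAt (fun s => ev x (sg lam B s (M (sg lam B (t - s) f) (sg lam B (t - s) f))))
      (ev x (sg lam B s (gen lam B (M (sg lam B (t - s) f) (sg lam B (t - s) f))
        - (M (gen lam B (sg lam B (t - s) f)) (sg lam B (t - s) f)
          + M (sg lam B (t - s) f) (gen lam B (sg lam B (t - s) f)))))) s := by
  have hP : HasDerivAt (fun u => sg lam B u) (sg lam B s * gen lam B) s :=
    hasDerivAt_exp_smul_const (𝕂 := ℝ) (gen lam B) s
  have hQ : HasDerivAt (fun u => sg lam B (t - u)) ((-1 : ℝ) • (gen lam B * sg lam B (t - s))) s :=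
    (hasDerivAt_exp_smul_const' (𝕂 := ℝ) (gen lam B) (t - s)).scomp s
    ((hasDerivAt_id s).const_sub t)
  have hg : HasDerivAt (fun u => sg lam B (t - u) f) (-(gen lam B (sg lam B (t - s) f))) s := by
    refine (hQ.clm_apply (hasDerivAt_const s f)).congr_deriv ?_
    simp
  have hgg := (M.hasFDerivAt.comp_hasDerivAt s hg).clm_apply hg
  have hF := hP.clm_apply hgg
  have hx := (ev x).hasFDerivAt.comp_hasDerivAt s hF
  refine hx.congr_deriv ?_
  congr 1
  simp [sub_eq_add_neg, add_comm]

theorem mono_aux {F F' : ℝ → ℝ} (hF : ∀ s, HasDerivAt F (F' s) s) {t : ℝ} (ht : 0 ≤ t)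
    (h : ∀ s, 0 ≤ s → s ≤ t → 0 ≤ F' s) : F 0 ≤ F t := by
  have hm : MonotoneOn F (Set.Icc 0 t) := by
    refine monotoneOn_of_deriv_nonneg (convex_Icc _ _)
      (fun s _ => (hF s).continuousAt.continuousWithinAt)
      (fun s _ => (hF s).differentiableAt.differentiableWithinAt) ?_
    intro s hs
    rw [interior_Icc] at hs
    rw [(hF s).deriv]
    exact h s hs.1.le hs.2.le
  exact hm ⟨le_rfl, ht⟩ ⟨ht, le_rfl⟩ ht

theorem deriv_ge (hM : IsMul ev M o) (hlam : ∀ r, 0 < lam r) (hB : ∀ r, PosOp ev (B r))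
    (h1 : ∀ r, B r o = o) (g : V) (x : Y) {s : ℝ} (hs : 0 ≤ s) :
    ∑ r, lam r * ev x (sg lam B s (M ((B r - 1) g) ((B r - 1) g)))
      ≤ ev x (sg lam B s (gen lam B (M g g) - (M (gen lam B g) g + M g (gen lam B g)))) := by
  have := (sg_pos lam B hlam hB hs).mono (gamma_ge lam B hM hlam hB h1 g) x
  refine le_trans (le_of_eq ?_) this
  simp only [map_sum, map_smul, smul_eq_mul]

theorem comm_aux (hc : ∀ r s, Commute (B r) (B s)) (r : Fin d) (s t : ℝ) (f : V) :
    (B r - 1) (sg lam B t f) = sg lam B s ((B r - 1) (sg lam B (t - s) f)) := by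
  have h4 : (B r - 1) * sg lam B t = sg lam B s * ((B r - 1) * sg lam B (t - s)) := by
    rw [← mul_assoc, ← (sg_comm lam B hc r s).eq, mul_assoc, ← sg_add]
    congr 2; ring
  exact congrArg (fun T : V →L[ℝ] V => T f) h4

theorem level_one (hM : IsMul ev M o) (hlam : ∀ r, 0 < lam r) (hB : ∀ r, PosOp ev (B r))
    (h1 : ∀ r, B r o = o)
    (hc : ∀ r s, Commute (B r) (B s)) {t : ℝ} (ht : 0 ≤ t) (f : V) (x : Y) :
    t * ∑ r, lam r * (ev x ((B r - 1) (sg lam B t f))) ^ 2 ≤ ev x (sg lam B t (M f f)) := by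
  set K := ∑ r, lam r * (ev x ((B r - 1) (sg lam B t f))) ^ 2 with hK
  have hm := mono_aux (fun s => (sg_deriv (ev := ev) lam B M t s f x).sub
    ((hasDerivAt_id s).mul_const K)) ht ?_
  · have h0 : 0 ≤ (ev x (sg lam B t f)) * (ev x (sg lam B t f)) := mul_self_nonneg _
    simp [sg_zero, hM.mul] at hm
    linarith
  · intro s hs hst
    have h2 := deriv_ge lam B hM hlam hB h1 (sg lam B (t - s) f) x hs
    refine sub_nonneg.2 (le_trans ?_ h2)
    rw [one_mul, hK]
    refine Finset.sum_le_sum fun r _ => mul_le_mul_of_nonneg_left ?_ (hlam r).le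
    have h3 := (sg_pos lam B hlam hB hs).jensen hM (sg_one lam B h1 s)
      ((B r - 1) (sg lam B (t - s) f)) x
    rw [comm_aux lam B hc r s t f]
    exact h3

theorem level_two (hM : IsMul ev M o) (hlam : ∀ r, 0 < lam r) (hB : ∀ r, PosOp ev (B r))
    (h1 : ∀ r, B r o = o)
    (hc : ∀ r s, Commute (B r) (B s)) {t : ℝ} (ht : 0 ≤ t) (f : V) (x : Y) :
    t ^ 2 / 2 * ∑ r, ∑ q, lam r * lam q * (ev x ((B q - 1) ((B r - 1) (sg lam B t f)))) ^ 2
      ≤ ev x (sg lam B t (M f f)) := by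
  set K := ∑ r, ∑ q, lam r * lam q * (ev x ((B q - 1) ((B r - 1) (sg lam B t f)))) ^ 2 with hK
  have hm := mono_aux (fun s => (sg_deriv (ev := ev) lam B M t s f x).sub
    ((((hasDerivAt_id s).pow 2).div_const 2).mul_const K)) ht ?_
  · have h0 : 0 ≤ (ev x (sg lam B t f)) * (ev x (sg lam B t f)) := mul_self_nonneg _
    simp [sg_zero, hM.mul] at hm
    linarith
  · intro s hs hst
    have h2 := deriv_ge lam B hM hlam hB h1 (sg lam B (t - s) f) x hs
    refine sub_nonneg.2 (le_trans ?_ h2)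
    have e : ((2 : ℕ) * (id s) ^ (2 - 1) * 1 / 2 * K : ℝ) = s * K := by
      simp
    refine le_trans (le_of_eq e) ?_
    rw [hK, Finset.mul_sum]
    refine Finset.sum_le_sum fun r _ => ?_
    have h3 := level_one lam B hM hlam hB h1 hc hs ((B r - 1) (sg lam B (t - s) f)) x
    refine le_trans (le_of_eq ?_) (mul_le_mul_of_nonneg_left h3 (hlam r).le)
    rw [comm_aux lam B hc r s t f, Finset.mul_sum, Finset.mul_sum, Finset.mul_sum]
    refine Finset.sum_congr rfl fun q _ => ?_
    ring

theorem sg_sq_le (hM : IsMul ev M o) (hlam : ∀ r, 0 < lam r) (hB : ∀ r, PosOp ev (B r))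
    (h1 : ∀ r, B r o = o)
    (f : V) (hf : ∀ x, |ev x f| ≤ 1) (x : Y) : ev x (sg lam B 1 (M f f)) ≤ 1 := by
  have h := (sg_pos lam B hlam hB zero_le_one).mono (f := M f f) (g := o) (fun y => by
    have := abs_le.1 (hf y)
    rw [hM.mul, hM.one]
    nlinarith) x
  rw [sg_one lam B h1, hM.one] at h
  exact h

end Markov

end PaperL1

namespace PaperL1

open scoped ENNReal

section Concrete

/-- Bounded functions. -/
abbrev BF (X : Type*) := lp (fun _ : X => ℝ) ∞

variable {X : Type*}

/-- Evaluation. -/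
def evl (x : X) : BF X →L[ℝ] ℝ := lp.evalCLM ℝ (fun _ : X => ℝ) ∞ x

theorem evl_apply (x : X) (f : BF X) : evl x f = f x := rfl

theorem evl_le (x : X) (f : BF X) : |evl x f| ≤ ‖f‖ := by
  have := lp.norm_apply_le_norm (p := ∞) (by simp) f x
  simpa [evl_apply] using this

theorem bf_ext {f g : BF X} (h : ∀ x, evl x f = evl x g) : f = g :=
  lp.ext (funext h)

/-- Bundle a bounded function. -/
def mkBF (f : X → ℝ) (C : ℝ) (h : ∀ x, |f x| ≤ C) : BF X :=
  ⟨f, memℓp_infty ⟨C, by rintro _ ⟨x, rfl⟩; exact h x⟩⟩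

theorem evl_mkBF (f : X → ℝ) (C : ℝ) (h : ∀ x, |f x| ≤ C) (x : X) : evl x (mkBF f C h) = f x := rfl

theorem bf_norm_le {f : BF X} {C : ℝ} (hC : 0 ≤ C) (h : ∀ x, |evl x f| ≤ C) : ‖f‖ ≤ C :=
  lp.norm_le_of_forall_le hC h

/-- Constant one. -/
def oneBF : BF X := mkBF (fun _ => 1) 1 (by simp)

/-- Pointwise multiplication. -/
def mulBF : BF X →L[ℝ] BF X →L[ℝ] BF X :=
  LinearMap.mkContinuous₂ (LinearMap.mk₂ ℝ
    (fun f g => mkBF (fun x => evl x f * evl x g) (‖f‖ * ‖g‖) (fun x => by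
      rw [abs_mul]
      exact mul_le_mul (evl_le x f) (evl_le x g) (abs_nonneg _) (norm_nonneg _)))
    (fun f f' g => bf_ext fun x => by simp only [map_add, evl_mkBF]; ring)
    (fun c f g => bf_ext fun x => by simp only [map_smul, evl_mkBF, smul_eq_mul]; ring)
    (fun f g g' => bf_ext fun x => by simp only [map_add, evl_mkBF]; ring)
    (fun c f g => bf_ext fun x => by simp only [map_smul, evl_mkBF, smul_eq_mul]; ring)) 1
    (fun f g => bf_norm_le (by positivity) fun x => by
      change |evl x f * evl x g| ≤ _
      rw [abs_mul, one_mul]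
      exact mul_le_mul (evl_le x f) (evl_le x g) (abs_nonneg _) (norm_nonneg _))

theorem isMul : IsMul (evl (X := X)) mulBF oneBF where
  mul := fun _ _ _ => rfl
  one := fun _ => rfl

variable [AddCommMonoid X]

theorem summable_T {h : X → ℝ} (hs : Summable h) (f : BF X) (x : X) :
    Summable (fun u => h u * evl (x + u) f) := by
  refine Summable.of_norm_bounded (hs.abs.mul_right ‖f‖) fun u => ?_
  rw [Real.norm_eq_abs, abs_mul]
  exact mul_le_mul_of_nonneg_left (evl_le _ _) (abs_nonneg _)

theorem T_bound {h : X → ℝ} (hs : Summable h) (f : BF X) (x : X) :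
    |∑' u, h u * evl (x + u) f| ≤ (∑' u, |h u|) * ‖f‖ := by
  rw [← tsum_mul_right, ← Real.norm_eq_abs]
  refine tsum_of_norm_bounded (hs.abs.mul_right ‖f‖).hasSum fun u => ?_
  rw [Real.norm_eq_abs, abs_mul]
  exact mul_le_mul_of_nonneg_left (evl_le _ _) (abs_nonneg _)

/-- The operator of (adjoint) convolution with `h`. -/
def T (h : X → ℝ) (hs : Summable h) : BF X →L[ℝ] BF X :=
  LinearMap.mkContinuous
    { toFun := fun f => mkBF (fun x => ∑' u, h u * evl (x + u) f) _ (T_bound hs f)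
      map_add' := fun f g => bf_ext fun x => by
        simp only [map_add, evl_mkBF, mul_add]
        exact (summable_T hs f x).tsum_add (summable_T hs g x)
      map_smul' := fun c f => bf_ext fun x => by
        simp only [map_smul, evl_mkBF, smul_eq_mul, RingHom.id_apply]
        rw [← tsum_mul_left]
        refine tsum_congr fun u => ?_
        ring }
    (∑' u, |h u|)
    (fun f => bf_norm_le (mul_nonneg (tsum_nonneg fun _ => abs_nonneg _) (norm_nonneg _))
      fun x => T_bound hs f x)

theorem T_apply (h : X → ℝ) (hs : Summable h) (f : BF X) (x : X) :
    evl x (T h hs f) = ∑' u, h u * evl (x + u) f := rfl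

theorem T_congr {h k : X → ℝ} (e : h = k) (hs : Summable h) (ks : Summable k) :
    T h hs = T k ks := by subst e; rfl

theorem T_ext {S S' : BF X →L[ℝ] BF X} (h : ∀ f x, evl x (S f) = evl x (S' f)) : S = S' :=
  ContinuousLinearMap.ext fun f => bf_ext fun x => h f x

theorem T_pos {h : X → ℝ} (hs : Summable h) (h0 : ∀ x, 0 ≤ h x) : PosOp evl (T h hs) := by
  intro f hf x
  rw [T_apply]
  exact tsum_nonneg fun u => mul_nonneg (h0 u) (hf _)

theorem T_one {h : X → ℝ} (hs : HasSum h 1) : T h hs.summable oneBF = oneBF := by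
  refine bf_ext fun x => ?_
  rw [T_apply]
  simp [isMul.one, hs.tsum_eq]

theorem summable_pair {h k : X → ℝ} (hs : Summable h) (ks : Summable k) :
    Summable (fun p : X × X => |h p.1 * k p.2|) := by
  have := Summable.mul_of_nonneg hs.abs ks.abs (fun _ => abs_nonneg _) (fun _ => abs_nonneg _)
  simpa only [abs_mul] using this

/-- Fibering of `X × X` by the sum. -/
def fib (X : Type*) [AddCommMonoid X] :
    (Σ z : X, {p : X × X // p.1 + p.2 = z}) ≃ X × X :=
  Equiv.sigmaFiberEquiv (fun p : X × X => p.1 + p.2)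

theorem conv_abs_sum {h k : X → ℝ} (hs : Summable h) (ks : Summable k) :
    Summable (fun z => |conv h k z|) ∧
      ∑' z, |conv h k z| ≤ (∑' u, |h u|) * ∑' u, |k u| := by
  have s1 := (fib X).summable_iff.2 (summable_pair hs ks)
  have b : ∀ z, |conv h k z| ≤ ∑' p : {p : X × X // p.1 + p.2 = z}, |h p.1.1 * k p.1.2| := by
    intro z
    rw [conv, ← Real.norm_eq_abs]
    exact norm_tsum_le_tsum_norm (s1.sigma_factor z)
  have s2 : Summable fun z => ∑' p : {p : X × X // p.1 + p.2 = z}, |h p.1.1 * k p.1.2| := s1.sigma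
  have s3 := Summable.of_nonneg_of_le (fun _ => abs_nonneg _) b s2
  refine ⟨s3, (s3.tsum_le_tsum b s2).trans (le_of_eq ?_)⟩
  have e1 : ∑' z, ∑' p : {p : X × X // p.1 + p.2 = z}, |h p.1.1 * k p.1.2|
      = ∑' p : X × X, |h p.1 * k p.2| := by
    rw [← (fib X).tsum_eq]
    exact s1.tsum_sigma.symm
  rw [e1, (summable_pair hs ks).tsum_prod]
  simp only [abs_mul, tsum_mul_left, tsum_mul_right]

theorem conv_summable {h k : X → ℝ} (hs : Summable h) (ks : Summable k) :
    Summable (conv h k) := (conv_abs_sum hs ks).1.of_abs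

theorem T_conv {h k : X → ℝ} (hs : Summable h) (ks : Summable k) :
    T (conv h k) (conv_summable hs ks) = T h hs * T k ks := by
  refine T_ext fun f x => ?_
  change _ = evl x (T h hs (T k ks f))
  simp only [T_apply]
  have s0 : Summable (fun p : X × X => h p.1 * k p.2 * evl (x + (p.1 + p.2)) f) := by
    refine Summable.of_norm_bounded ((summable_pair hs ks).mul_right ‖f‖) fun p => ?_
    rw [Real.norm_eq_abs, abs_mul]
    exact mul_le_mul_of_nonneg_left (evl_le _ _) (abs_nonneg _)
  have s1 := (fib X).summable_iff.2 s0
  have e1 : ∑' u, conv h k u * evl (x + u) f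
      = ∑' p : X × X, h p.1 * k p.2 * evl (x + (p.1 + p.2)) f := by
    rw [← (fib X).tsum_eq]
    refine Eq.trans ?_ s1.tsum_sigma.symm
    refine tsum_congr fun z => ?_
    rw [conv, ← tsum_mul_right]
    refine tsum_congr fun p => ?_
    change _ = h p.1.1 * k p.1.2 * evl (x + (p.1.1 + p.1.2)) f
    rw [p.2]
  rw [e1, s0.tsum_prod]
  refine tsum_congr fun u => ?_
  rw [← tsum_mul_left]
  refine tsum_congr fun v => ?_
  rw [add_assoc, mul_assoc]

theorem conv_comm (h k : X → ℝ) : conv h k = conv k h := by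
  funext x
  let e : {p : X × X // p.1 + p.2 = x} ≃ {p : X × X // p.1 + p.2 = x} :=
    (Equiv.prodComm X X).subtypeEquiv (fun p => by simp [add_comm])
  rw [conv, conv, ← e.tsum_eq]
  exact tsum_congr fun p => mul_comm _ _

theorem T_comm {h k : X → ℝ} (hs : Summable h) (ks : Summable k) :
    Commute (T h hs) (T k ks) := by
  change T h hs * T k ks = T k ks * T h hs
  rw [← T_conv, ← T_conv]
  exact T_congr (conv_comm h k) _ _

theorem delta_hasSum : HasSum (delta (0 : X)) 1 := by
  have := hasSum_ite_eq (0 : X) (1 : ℝ)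
  exact this

theorem T_delta : T (delta (0 : X)) delta_hasSum.summable = 1 := by
  refine T_ext fun f x => ?_
  rw [T_apply, tsum_eq_single 0]
  · simp [delta]
  · intro u hu
    simp [delta, hu]

theorem convPow_bd {h : X → ℝ} (hs : Summable h) (n : ℕ) :
    Summable (convPow h n) ∧ ∑' u, |convPow h n u| ≤ (∑' u, |h u|) ^ n := by
  induction n with
  | zero =>
    refine ⟨delta_hasSum.summable, le_of_eq ?_⟩
    have : (fun u : X => |convPow h 0 u|) = delta 0 := by
      funext u
      by_cases hu : u = 0 <;> simp [convPow, delta, hu]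
    rw [this, delta_hasSum.tsum_eq, pow_zero]
  | succ n ih =>
    refine ⟨conv_summable hs ih.1, ?_⟩
    rw [pow_succ']
    exact (conv_abs_sum hs ih.1).2.trans
      (mul_le_mul_of_nonneg_left ih.2 (tsum_nonneg fun _ => abs_nonneg _))

theorem T_pow {h : X → ℝ} (hs : Summable h) (n : ℕ) :
    T (convPow h n) (convPow_bd hs n).1 = T h hs ^ n := by
  induction n with
  | zero => exact T_delta.trans (pow_zero _).symm
  | succ n ih =>
    refine (T_conv hs (convPow_bd hs n).1).trans ?_
    rw [ih]
    exact (pow_succ' _ _).symm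

theorem exp_pair {h : X → ℝ} (hs : Summable h) :
    Summable (fun p : ℕ × X => |((p.1.factorial : ℝ))⁻¹ * convPow h p.1 p.2|) := by
  have h0 : (0 : ℕ × X → ℝ) ≤ fun p => |((p.1.factorial : ℝ))⁻¹ * convPow h p.1 p.2| :=
    fun p => abs_nonneg (((p.1.factorial : ℝ))⁻¹ * convPow h p.1 p.2)
  have hA : ∀ n : ℕ, Summable fun u => |((n.factorial : ℝ))⁻¹ * convPow h n u| :=
    fun n => ((convPow_bd hs n).1.mul_left ((n.factorial : ℝ))⁻¹).abs
  have hB : Summable fun n : ℕ => ∑' u, |((n.factorial : ℝ))⁻¹ * convPow h n u| := by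
    refine Summable.of_nonneg_of_le (fun n => tsum_nonneg fun u => abs_nonneg _) (fun n => ?_)
      (Real.summable_pow_div_factorial (∑' u, |h u|))
    have hn : (0 : ℝ) ≤ ((n.factorial : ℝ))⁻¹ := by positivity
    simp only [abs_mul, tsum_mul_left]
    rw [abs_of_nonneg hn, div_eq_inv_mul]
    exact mul_le_mul_of_nonneg_left (convPow_bd hs n).2 hn
  exact (summable_prod_of_nonneg h0).2 ⟨hA, hB⟩

theorem convExp_summable {h : X → ℝ} (hs : Summable h) : Summable (convExp h) := by
  have := (exp_pair hs).of_abs.prod_symm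
  exact this.prod

theorem T_exp {h : X → ℝ} (hs : Summable h) :
    T (convExp h) (convExp_summable hs) = NormedSpace.exp (T h hs) := by
  refine T_ext fun f x => ?_
  have h1 := (NormedSpace.exp_series_hasSum_exp' (𝕂 := ℝ) (T h hs)).mapL
    ((evl x).comp (ContinuousLinearMap.apply ℝ _ f))
  refine Eq.trans ?_ h1.tsum_eq
  rw [T_apply]
  have s0 : Summable (Function.uncurry fun (n : ℕ) (u : X) =>
      ((n.factorial : ℝ))⁻¹ * convPow h n u * evl (x + u) f) := by
    refine Summable.of_norm_bounded ((exp_pair hs).mul_right ‖f‖) fun p => ?_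
    rw [Function.uncurry, Real.norm_eq_abs, abs_mul]
    exact mul_le_mul_of_nonneg_left (evl_le _ _) (abs_nonneg _)
  have e := s0.tsum_comm
  simp only [convExp, ← tsum_mul_right]
  rw [e]
  refine tsum_congr fun n => ?_
  have e3 : ((evl x).comp (ContinuousLinearMap.apply ℝ _ f))
      (((n.factorial : ℝ)⁻¹) • T h hs ^ n) = (n.factorial : ℝ)⁻¹ * evl x ((T h hs ^ n) f) := rfl
  rw [e3, ← T_pow hs n, T_apply, ← tsum_mul_left]
  exact tsum_congr fun u => mul_assoc _ _ _

theorem sum_summable {d : ℕ} (p : Fin d → ℝ) {W : Fin d → X → ℝ} (hW : ∀ r, Summable (W r)) :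
    Summable (∑ r, p r • W r) := by
  have : Summable fun u => ∑ r, p r * W r u := summable_sum fun r _ => (hW r).mul_left (p r)
  convert this using 1
  funext u
  simp

theorem T_sum {d : ℕ} (p : Fin d → ℝ) {W : Fin d → X → ℝ} (hW : ∀ r, Summable (W r)) (f : BF X)
    (x : X) :
    evl x (T (∑ r, p r • W r) (sum_summable p hW) f) = ∑ r, p r * evl x (T (W r) (hW r) f) := by
  simp only [T_apply, ← tsum_mul_left]
  rw [← Summable.tsum_finsetSum (fun r _ => (summable_T (hW r) f x).mul_left (p r))]
  refine tsum_congr fun u => ?_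
  simp [Finset.sum_mul, mul_assoc]

theorem T_sub {h k : X → ℝ} (hs : Summable h) (ks : Summable k) :
    T (h - k) (hs.sub ks) = T h hs - T k ks := by
  refine T_ext fun f x => ?_
  change _ = evl x (T h hs f - T k ks f)
  rw [map_sub]
  simp only [T_apply]
  rw [← (summable_T hs f x).tsum_sub (summable_T ks f x)]
  exact tsum_congr fun u => sub_mul _ _ _

theorem exists_sign {h : X → ℝ} (hs : Summable h) :
    ∃ f : BF X, (∀ x, |evl x f| ≤ 1) ∧ l1norm h = evl 0 (T h hs f) := by
  have hb : ∀ x, |(SignType.sign (h x) : ℝ)| ≤ 1 := by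
    intro x
    rcases lt_trichotomy (h x) 0 with h0 | h0 | h0 <;> simp [h0]
  refine ⟨mkBF (fun x => (SignType.sign (h x) : ℝ)) 1 hb, fun x => hb x, ?_⟩
  rw [T_apply, l1norm]
  refine tsum_congr fun u => ?_
  rw [evl_mkBF, zero_add, self_mul_sign]

end Concrete

end PaperL1

namespace PaperL1

theorem cs_aux {ι : Type*} (s : Finset ι) (p a l : ι → ℝ) (hl : ∀ i, 0 < l i) {C : ℝ}
    (h : ∑ i ∈ s, l i * a i ^ 2 ≤ C) :
    ∑ i ∈ s, p i * a i ≤ Real.sqrt (C * ∑ i ∈ s, p i ^ 2 / l i) := by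
  refine Real.le_sqrt_of_sq_le ?_
  have h1 := Finset.sum_sq_le_sum_mul_sum_of_sq_eq_mul s (r := fun i => p i * a i)
    (f := fun i => l i * a i ^ 2) (g := fun i => p i ^ 2 / l i)
    (fun i _ => mul_nonneg (hl i).le (sq_nonneg _))
    (fun i _ => div_nonneg (sq_nonneg _) (hl i).le)
    (fun i _ => by have := (hl i).ne'; field_simp)
  exact h1.trans (mul_le_mul_of_nonneg_right h
    (Finset.sum_nonneg fun i _ => div_nonneg (sq_nonneg _) (hl i).le))

theorem part_three {d : ℕ} (p₁ p₂ : Fin d → ℝ) (lam : Fin d → ℝ) (hlam : ∀ r, 0 < lam r) :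
    Real.sqrt ((2:ℝ)⁻¹ * ∑ r, ∑ s,
        (p₁ r * p₂ s + p₁ s * p₂ r) ^ 2 / (lam r * lam s)) ≤
      Real.sqrt 2 * (Real.sqrt (∑ r, (p₁ r) ^ 2 / lam r) *
        Real.sqrt (∑ r, (p₂ r) ^ 2 / lam r)) := by
  have n1 : 0 ≤ ∑ r, (p₁ r) ^ 2 / lam r :=
    Finset.sum_nonneg fun i _ => div_nonneg (sq_nonneg _) (hlam i).le
  rw [← Real.sqrt_mul n1, ← Real.sqrt_mul (by norm_num)]
  refine Real.sqrt_le_sqrt ?_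
  have e1 : (∑ r, (p₁ r) ^ 2 / lam r) * (∑ r, (p₂ r) ^ 2 / lam r)
      = ∑ r, ∑ s, (p₁ r * p₂ s) ^ 2 / (lam r * lam s) := by
    rw [Finset.sum_mul_sum]
    refine Finset.sum_congr rfl fun r _ => Finset.sum_congr rfl fun s _ => ?_
    rw [div_mul_div_comm, mul_pow]
  have e2 : (∑ r, (p₁ r) ^ 2 / lam r) * (∑ r, (p₂ r) ^ 2 / lam r)
      = ∑ r, ∑ s, (p₁ s * p₂ r) ^ 2 / (lam r * lam s) := by
    rw [e1, Finset.sum_comm]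
    refine Finset.sum_congr rfl fun r _ => Finset.sum_congr rfl fun s _ => ?_
    rw [mul_comm (lam s)]
  have h : ∑ r, ∑ s, (p₁ r * p₂ s + p₁ s * p₂ r) ^ 2 / (lam r * lam s)
      ≤ 2 * (∑ r, ∑ s, (p₁ r * p₂ s) ^ 2 / (lam r * lam s))
        + 2 * ∑ r, ∑ s, (p₁ s * p₂ r) ^ 2 / (lam r * lam s) := by
    simp only [Finset.mul_sum, ← Finset.sum_add_distrib]
    refine Finset.sum_le_sum fun r _ => Finset.sum_le_sum fun s _ => ?_
    have hp : 0 < lam r * lam s := mul_pos (hlam r) (hlam s)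
    rw [← mul_div_assoc, ← mul_div_assoc, ← add_div]
    refine div_le_div_of_nonneg_right ?_ hp.le
    nlinarith [sq_nonneg (p₁ r * p₂ s - p₁ s * p₂ r)]
  rw [← e1, ← e2] at h
  linarith

end PaperL1


/-- Corollary 4.2 of Roos: the cases `k = 1` and `k = 2` of the smoothness
estimate: `‖R₁ G‖ ≤ (Σ_r p_{1,r}²/λ_r)^{1/2}` and
`‖R₁ R₂ G‖ ≤ ((1/2) Σ_{r,s} (p_{1,r}p_{2,s}+p_{1,s}p_{2,r})²/(λ_rλ_s))^{1/2}
≤ √2 (Σ_r p_{1,r}²/λ_r)^{1/2} (Σ_r p_{2,r}²/λ_r)^{1/2}`. -/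
theorem smoothness_estimate_k_one_two
    {X : Type*} [AddCommMonoid X] [Countable X]
    (d : ℕ) (hd : 1 ≤ d)
    (p₁ p₂ : Fin d → ℝ) (lam : Fin d → ℝ) (hlam : ∀ r, 0 < lam r)
    (U : Fin d → X → ℝ) (hU : ∀ r, IsPmf (U r))
    (W : Fin d → X → ℝ) (hW : ∀ r, W r = U r - delta 0)
    (R₁ R₂ : X → ℝ) (hR₁ : R₁ = ∑ r, p₁ r • W r) (hR₂ : R₂ = ∑ r, p₂ r • W r)
    (G : X → ℝ) (hG : G = convExp (∑ r, lam r • W r)) :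
    l1norm (conv R₁ G) ≤ Real.sqrt (∑ r, (p₁ r) ^ 2 / lam r) ∧
    l1norm (conv R₁ (conv R₂ G)) ≤
      Real.sqrt ((2:ℝ)⁻¹ * ∑ r, ∑ s,
        (p₁ r * p₂ s + p₁ s * p₂ r) ^ 2 / (lam r * lam s)) ∧
    Real.sqrt ((2:ℝ)⁻¹ * ∑ r, ∑ s,
        (p₁ r * p₂ s + p₁ s * p₂ r) ^ 2 / (lam r * lam s)) ≤
      Real.sqrt 2 * (Real.sqrt (∑ r, (p₁ r) ^ 2 / lam r) *
        Real.sqrt (∑ r, (p₂ r) ^ 2 / lam r)) := by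
  have hUs : ∀ r, Summable (U r) := fun r => (hU r).2.summable
  have hWs : ∀ r, Summable (W r) := fun r => by
    rw [hW r]; exact (hUs r).sub delta_hasSum.summable
  let B : Fin d → BF X →L[ℝ] BF X := fun r => T (U r) (hUs r)
  have hTW : ∀ r, T (W r) (hWs r) = B r - 1 := fun r => by
    rw [T_congr (hW r) (hWs r) ((hUs r).sub delta_hasSum.summable), T_sub (hUs r) delta_hasSum.summable, T_delta]
  have hpos : ∀ r, PosOp evl (B r) := fun r => T_pos (hUs r) (hU r).1
  have hone : ∀ r, B r oneBF = oneBF := fun r => T_one (hU r).2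
  have hc : ∀ r s, Commute (B r) (B s) := fun r s => T_comm _ _
  have hLs := sum_summable lam hWs
  have hgen : T (∑ r, lam r • W r) hLs = gen lam B := by
    refine T_ext fun f x => ?_
    rw [T_sum lam hWs, gen_apply, map_sum]
    refine Finset.sum_congr rfl fun r _ => ?_
    rw [map_smul, hTW r]
    rfl
  have hGs : Summable G := by rw [hG]; exact convExp_summable hLs
  have hTG : T G hGs = sg lam B 1 := by
    rw [T_congr hG hGs (convExp_summable hLs), T_exp hLs, hgen, sg, one_smul]
  have hR₁s : Summable R₁ := by rw [hR₁]; exact sum_summable p₁ hWs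
  have hR₂s : Summable R₂ := by rw [hR₂]; exact sum_summable p₂ hWs
  have hT₁ : ∀ f x, evl x (T R₁ hR₁s f) = ∑ r, p₁ r * evl x ((B r - 1) f) := fun f x => by
    rw [T_congr hR₁ hR₁s (sum_summable p₁ hWs), T_sum p₁ hWs]
    simp only [hTW]
  have hT₂ : T R₂ hR₂s = ∑ r, p₂ r • (B r - 1) := by
    refine T_ext fun f x => ?_
    rw [T_congr hR₂ hR₂s (sum_summable p₂ hWs), T_sum p₂ hWs]
    simp only [hTW]
    change _ = evl x (gen p₂ B f)
    rw [gen_apply, map_sum]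
    refine Finset.sum_congr rfl fun r _ => ?_
    rw [map_smul]
    rfl
  refine ⟨?_, ?_, part_three p₁ p₂ lam hlam⟩
  · obtain ⟨f, hf, hn⟩ := exists_sign (conv_summable hR₁s hGs)
    rw [hn, T_conv hR₁s hGs, hTG]
    change evl 0 (T R₁ hR₁s (sg lam B 1 f)) ≤ _
    rw [hT₁]
    have h1 := level_one lam B isMul hlam hpos hone hc zero_le_one f 0
    have h2 := sg_sq_le lam B isMul hlam hpos hone f hf 0
    rw [one_mul] at h1
    have h3 := cs_aux Finset.univ p₁ _ lam hlam (h1.trans h2)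
    rwa [one_mul] at h3
  · obtain ⟨f, hf, hn⟩ := exists_sign (conv_summable hR₁s (conv_summable hR₂s hGs))
    rw [hn, T_conv hR₁s (conv_summable hR₂s hGs), T_conv hR₂s hGs, hTG]
    change evl 0 (T R₁ hR₁s (T R₂ hR₂s (sg lam B 1 f))) ≤ _
    have h1 := level_two lam B isMul hlam hpos hone hc zero_le_one f 0
    have h2 := sg_sq_le lam B isMul hlam hpos hone f hf 0
    let a : Fin d → Fin d → ℝ := fun r q => evl 0 ((B q - 1) ((B r - 1) (sg lam B 1 f)))
    have ha : ∀ r q, a r q = a q r := fun r q => by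
      have h4 : (B q - 1) * (B r - 1) = (B r - 1) * (B q - 1) :=
        (((hc q r).sub_right (Commute.one_right _)).sub_left (Commute.one_left _)).eq
      exact congrArg (fun S : BF X →L[ℝ] BF X => evl 0 (S (sg lam B 1 f))) h4
    have h5 : ∑ i : Fin d × Fin d, (lam i.1 * lam i.2) * (a i.1 i.2) ^ 2 ≤ 2 := by
      rw [Fintype.sum_prod_type]
      have := h1.trans h2
      change 1 ^ 2 / 2 * ∑ r, ∑ q, lam r * lam q * (a r q) ^ 2 ≤ 1 at this
      linarith
    have h6 := cs_aux Finset.univ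
      (fun i : Fin d × Fin d => (p₁ i.1 * p₂ i.2 + p₁ i.2 * p₂ i.1) / 2)
      (fun i => a i.1 i.2) (fun i => lam i.1 * lam i.2)
      (fun i => mul_pos (hlam _) (hlam _)) h5
    simp only [Fintype.sum_prod_type] at h6
    have e1 : evl 0 (T R₁ hR₁s (T R₂ hR₂s (sg lam B 1 f)))
        = ∑ r, ∑ s, p₁ r * p₂ s * a s r := by
      rw [hT₁, hT₂]
      refine Finset.sum_congr rfl fun r _ => ?_
      have e : (∑ q, p₂ q • (B q - 1)) (sg lam B 1 f)
          = ∑ q, p₂ q • ((B q - 1) (sg lam B 1 f)) := gen_apply p₂ B (sg lam B 1 f)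
      rw [e, map_sum, map_sum, Finset.mul_sum]
      refine Finset.sum_congr rfl fun s _ => ?_
      rw [map_smul, map_smul, smul_eq_mul, mul_assoc]
    have e2 : ∑ r, ∑ s, p₁ r * p₂ s * a s r = ∑ r, ∑ s, p₁ s * p₂ r * a s r := by
      rw [Finset.sum_comm]
      refine Finset.sum_congr rfl fun r _ => Finset.sum_congr rfl fun s _ => ?_
      rw [ha]
    have e3 : ∑ r, ∑ s, (p₁ r * p₂ s + p₁ s * p₂ r) / 2 * a r s
        = ∑ r, ∑ s, p₁ r * p₂ s * a s r := by
      have : ∀ r s, (p₁ r * p₂ s + p₁ s * p₂ r) / 2 * a r s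
          = (p₁ r * p₂ s * a s r) / 2 + (p₁ s * p₂ r * a s r) / 2 := fun r s => by
        rw [ha r s]; ring
      simp only [this, Finset.sum_add_distrib, ← Finset.sum_div]
      rw [← e2]; ring
    have e4 : 2 * ∑ r, ∑ s, ((p₁ r * p₂ s + p₁ s * p₂ r) / 2) ^ 2 / (lam r * lam s)
        = (2:ℝ)⁻¹ * ∑ r, ∑ s, (p₁ r * p₂ s + p₁ s * p₂ r) ^ 2 / (lam r * lam s) := by
      simp only [Finset.mul_sum]
      refine Finset.sum_congr rfl fun r _ => Finset.sum_congr rfl fun s _ => ?_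
      ring
    rw [e1, ← e3, ← e4]
    exact h6
end
end
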